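/- Let α ≥ 0 be a real number. For all integers n ≥ N(3,α), Δ³ log r_α(n) < 0; equivalently, the sequence of ratios r_α(n+1)/r_α(n) is strictly log-concave for n ≥ N(3,α). -/

import Mathlib

open Real

/-- The overpartition function. -/
noncomputable def pbar (n : ℕ) : ℕ :=
  ∑ k ∈ Finset.range (n + 1),
    (Nat.Partition.distincts k).card * Fintype.card (Nat.Partition (n - k))

/-- `r_α(n) = (p̄(n)/n^α)^(1/n)`. -/
noncomputable def rseq (α : ℝ) (n : ℕ) : ℝ :=
  ((pbar n : ℝ) / (n : ℝ) ^ α) ^ ((n : ℝ)⁻¹)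

/-- Forward difference operator. -/
noncomputable def fdiff (f : ℕ → ℝ) : ℕ → ℝ := fun n => f (n + 1) - f n

/-- `C(r) = π (1/2)_r`. -/
noncomputable def Cr (r : ℕ) : ℝ := π * (ascPochhammer ℝ r).eval (1/2 : ℝ)

/-- `C(r,α) = (α+1) r! + (r−1)! log 8 + 1`. -/
noncomputable def Crα (r : ℕ) (α : ℝ) : ℝ :=
  (α + 1) * (Nat.factorial r) + (Nat.factorial (r - 1)) * Real.log 8 + 1

/-- `S_0 = 0`, `S_n = n S_{n−1} + (n−1)!`. -/
noncomputable def Sseq : ℕ → ℝ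
  | 0 => 0
  | n + 1 => (n + 1) * Sseq n + (Nat.factorial n)

noncomputable def N₀ (m : ℕ) : ℝ :=
  if m = 1 then 1 else 2 * m * Real.log m - m * Real.log (Real.log m)

noncomputable def N₁ (r : ℕ) : ℝ :=
  max (85 : ℝ) ((⌈(4 / π ^ 2) * (N₀ (2 * r + 2)) ^ 2⌉ : ℤ) : ℝ)

noncomputable def C₂ (r : ℕ) : ℝ :=
  (∑ k ∈ Finset.range (2 * r - 1),
    (1 / (((k : ℝ) + 1) ^ 2 * π ^ (k + 1))) *
      (ascPochhammer ℝ r).eval (((k : ℝ) + 1) / 2) * (1 / (r : ℝ) ^ k))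
  + 2 * r / 10 ^ r

noncomputable def N₂ (r : ℕ) : ℝ :=
  max ((⌈2 * (Cr r) ^ 2⌉ : ℤ) : ℝ)
    ((⌈((2 : ℝ) ^ (r + 1) / ((Nat.factorial (r - 1)) * Real.log 8)) ^ 2⌉ : ℤ) : ℝ)

noncomputable def N₃ (r : ℕ) (α : ℝ) : ℝ :=
  max (max (5505 : ℝ) (4 * (r : ℝ) ^ 2))
    (max ((⌈(4 * (r : ℝ) ^ 2 * Cr r + C₂ r) ^ ((4 : ℝ) / 3)⌉ : ℤ) : ℝ)
         ((⌈(Crα r α / Cr r) ^ 4⌉ : ℤ) : ℝ))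

noncomputable def Ncut (r : ℕ) (α : ℝ) : ℝ :=
  max (max (N₁ r) ((⌈Real.exp (Sseq r / (Nat.factorial r))⌉ : ℤ) : ℝ))
      (max (N₂ r) (N₃ r α))

namespace Overpartition

section GeneratingFunction
open PowerSeries Finset Filter Topology
open scoped PowerSeries.WithPiTopology

/-- The power series `f` converges absolutely at `q`, with value `a`. -/
def HasEval (f : ℝ⟦X⟧) (q a : ℂ) : Prop :=
  Summable (fun n => ‖((coeff n f : ℝ) : ℂ) * q ^ n‖) ∧
    ∑' n, ((coeff n f : ℝ) : ℂ) * q ^ n = a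

lemma HasEval.mul {f g : ℝ⟦X⟧} {q a b : ℂ} (hf : HasEval f q a) (hg : HasEval g q b) :
    HasEval (f * g) q (a * b) := by
  have key : ∀ n, ∑ kl ∈ antidiagonal n, (((coeff kl.1 f : ℝ) : ℂ) * q ^ kl.1) *
      (((coeff kl.2 g : ℝ) : ℂ) * q ^ kl.2) = ((coeff n (f * g) : ℝ) : ℂ) * q ^ n := by
    intro n
    rw [coeff_mul, Complex.ofReal_sum, sum_mul]
    refine sum_congr rfl fun kl hkl => ?_
    rw [← mem_antidiagonal.mp hkl, pow_add]
    push_cast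
    ring
  constructor
  · have h := summable_norm_sum_mul_antidiagonal_of_summable_norm hf.1 hg.1
    simpa only [key] using h
  · have h := tsum_mul_tsum_eq_tsum_sum_antidiagonal_of_summable_norm hf.1 hg.1
    rw [hf.2, hg.2] at h
    simp only [key] at h
    exact h.symm

lemma hasEval_finsupp {f : ℝ⟦X⟧} (s : Finset ℕ) (hs : ∀ n ∉ s, coeff n f = 0) (q : ℂ) :
    HasEval f q (∑ n ∈ s, ((coeff n f : ℝ) : ℂ) * q ^ n) :=
  ⟨summable_of_ne_finset_zero (s := s) fun n hn => by simp [hs n hn],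
    tsum_eq_sum fun n hn => by simp [hs n hn]⟩

lemma hasEval_one (q : ℂ) : HasEval 1 q 1 := by
  have h := hasEval_finsupp (f := 1) {0} (fun n hn => by
    rw [coeff_one, if_neg (by simpa using hn)]) q
  simpa using h

lemma hasEval_one_add_smul_X_pow (c : ℝ) {d : ℕ} (hd : d ≠ 0) (q : ℂ) :
    HasEval (1 + c • X ^ d) q (1 + c * q ^ d) := by
  have h := hasEval_finsupp (f := 1 + c • X ^ d) {0, d} (fun n hn => by
    simp only [mem_insert, mem_singleton, not_or] at hn
    simp [coeff_one, coeff_X_pow, hn.1, hn.2]) q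
  rw [sum_pair (Ne.symm hd)] at h
  simpa [coeff_one, coeff_X_pow, hd, Ne.symm hd] using h

/-- The series `∑ X^(dj)`. -/
def geomSeries (d : ℕ) : ℝ⟦X⟧ := PowerSeries.mk fun n => if d ∣ n then 1 else 0

lemma one_sub_mul_geomSeries {d : ℕ} (hd : d ≠ 0) :
    (1 + (-1 : ℝ) • X ^ d) * geomSeries d = 1 := by
  ext n
  rw [add_mul, one_mul, smul_mul_assoc, map_add, coeff_smul, coeff_X_pow_mul', coeff_one]
  simp only [geomSeries, coeff_mk]
  rcases lt_or_ge n d with h | h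
  · rw [if_neg (by omega : ¬ d ≤ n)]
    by_cases h0 : n = 0
    · simp [h0]
    · have : ¬ d ∣ n := fun hh => by have := Nat.le_of_dvd (by omega) hh; omega
      simp [h0, this]
  · have h0 : n ≠ 0 := by omega
    rw [if_pos h, if_neg h0]
    have : d ∣ n - d ↔ d ∣ n := (Nat.dvd_sub_iff_left h dvd_rfl)
    by_cases h1 : d ∣ n <;> simp [this, h1]

lemma tsum_X_pow_mul {d : ℕ} (hd : d ≠ 0) :
    ∑' j : ℕ, (X : ℝ⟦X⟧) ^ (d * j) = geomSeries d := by
  have h : (∑' j : ℕ, ((X : ℝ⟦X⟧) ^ d) ^ j) * (1 - X ^ d) = 1 :=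
    PowerSeries.WithPiTopology.tsum_pow_mul_one_sub_of_constantCoeff_eq_zero
      (by simp [hd])
  have h2 := one_sub_mul_geomSeries hd
  simp_rw [pow_mul]
  have h3 : (1 + (-1 : ℝ) • X ^ d : ℝ⟦X⟧) = 1 - X ^ d := by
    rw [neg_one_smul, sub_eq_add_neg]
  rw [h3] at h2
  calc _ = (∑' j : ℕ, ((X : ℝ⟦X⟧) ^ d) ^ j) * ((1 - X ^ d) * geomSeries d) := by rw [h2, mul_one]
    _ = _ := by rw [← mul_assoc, h, one_mul]

lemma hasEval_geomSeries {d : ℕ} (hd : d ≠ 0) {q : ℂ} (hq : ‖q‖ < 1) :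
    HasEval (geomSeries d) q (1 - q ^ d)⁻¹ := by
  have hs : Summable (fun n => ‖((coeff n (geomSeries d) : ℝ) : ℂ) * q ^ n‖) := by
    refine Summable.of_nonneg_of_le (fun n => norm_nonneg _) (fun n => ?_)
      (summable_geometric_of_lt_one (norm_nonneg q) hq)
    rw [norm_mul, norm_pow]
    have : ‖((coeff n (geomSeries d) : ℝ) : ℂ)‖ ≤ 1 := by
      simp only [geomSeries, coeff_mk]; split_ifs <;> simp
    exact mul_le_of_le_one_left (by positivity) this
  have h := (hasEval_one_add_smul_X_pow (-1) hd q).mul ⟨hs, rfl⟩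
  rw [one_sub_mul_geomSeries hd] at h
  have h1 := h.2.symm.trans (hasEval_one q).2
  refine ⟨hs, eq_inv_of_mul_eq_one_right ?_⟩
  simpa [sub_eq_add_neg] using h1

/-- The generating function of overpartitions with parts at most `M`. -/
noncomputable def truncSeries (M : ℕ) : ℝ⟦X⟧ :=
  ∏ i ∈ range M, (1 + (1 : ℝ) • X ^ (i + 1)) * geomSeries (i + 1)

/-- The value of the generating function of overpartitions with parts at most `M`. -/
noncomputable def truncProd (q : ℂ) (M : ℕ) : ℂ :=
  ∏ i ∈ range M, (1 + q ^ (i + 1)) * (1 - q ^ (i + 1))⁻¹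

lemma hasEval_truncSeries (M : ℕ) {q : ℂ} (hq : ‖q‖ < 1) :
    HasEval (truncSeries M) q (truncProd q M) := by
  induction M with
  | zero => simpa [truncSeries, truncProd] using hasEval_one q
  | succ M ih =>
    rw [truncSeries, truncProd, prod_range_succ, prod_range_succ]
    have h := hasEval_one_add_smul_X_pow 1 (Nat.succ_ne_zero M) q
    simp only [Complex.ofReal_one, one_mul] at h
    exact ih.mul (h.mul (hasEval_geomSeries (Nat.succ_ne_zero M) hq))

lemma coeff_mul_nonneg {f g : ℝ⟦X⟧} (hf : ∀ n, 0 ≤ coeff n f) (hg : ∀ n, 0 ≤ coeff n g) (n : ℕ) :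
    0 ≤ coeff n (f * g) := by
  rw [coeff_mul]
  exact sum_nonneg fun _ _ => mul_nonneg (hf _) (hg _)

lemma coeff_factor_nonneg (d n : ℕ) :
    0 ≤ coeff n ((1 + (1 : ℝ) • X ^ (d + 1)) * geomSeries (d + 1)) := by
  refine coeff_mul_nonneg (fun n => ?_) (fun n => ?_) n
  · simp only [one_smul, map_add, coeff_one, coeff_X_pow]
    split_ifs <;> norm_num
  · simp only [geomSeries, coeff_mk]; split_ifs <;> simp

lemma coeff_zero_factor (d : ℕ) :
    coeff 0 ((1 + (1 : ℝ) • X ^ (d + 1)) * geomSeries (d + 1)) = 1 := by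
  rw [coeff_mul]
  simp [geomSeries]

lemma coeff_truncSeries_nonneg (M n : ℕ) : 0 ≤ coeff n (truncSeries M) := by
  induction M generalizing n with
  | zero => simp only [truncSeries, range_zero, prod_empty, coeff_one]; split_ifs <;> norm_num
  | succ M ih =>
    rw [truncSeries, prod_range_succ]
    exact coeff_mul_nonneg ih (coeff_factor_nonneg M) n

lemma coeff_truncSeries_mono (n : ℕ) : Monotone fun M => coeff n (truncSeries M) := by
  refine monotone_nat_of_le_succ fun M => ?_
  have h : truncSeries (M + 1) = truncSeries M *
      ((1 + (1 : ℝ) • X ^ (M + 1)) * geomSeries (M + 1)) := by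
    rw [truncSeries, prod_range_succ]; rfl
  rw [h, coeff_mul]
  have := single_le_sum (f := fun p : ℕ × ℕ => coeff p.1 (truncSeries M) *
      coeff p.2 ((1 + (1 : ℝ) • X ^ (M + 1)) * geomSeries (M + 1)))
    (fun p _ => mul_nonneg (coeff_truncSeries_nonneg M _) (coeff_factor_nonneg M _))
    (show (n, 0) ∈ antidiagonal n by simp)
  simpa only [coeff_zero_factor, mul_one] using this

lemma tendsto_coeff_truncSeries (n : ℕ) :
    Tendsto (fun M => coeff n (truncSeries M)) atTop (𝓝 (pbar n : ℝ)) := by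
  have h1 := Nat.Partition.hasProd_powerSeriesMk_card_restricted ℝ (fun _ => True)
  have h2 := Nat.Partition.hasProd_powerSeriesMk_card_countRestricted ℝ (m := 2) (by norm_num)
  have h := (h2.mul h1).tendsto_prod_nat
  have h' := ((PowerSeries.WithPiTopology.continuous_coeff ℝ n).tendsto _).comp h
  convert h' using 1
  · ext M
    simp only [Function.comp, truncSeries]
    congr 1
    refine prod_congr rfl fun i _ => ?_
    rw [if_pos trivial, tsum_X_pow_mul (Nat.succ_ne_zero i)]
    simp [sum_range_succ]
  · rw [coeff_mul, pbar, Nat.sum_antidiagonal_eq_sum_range_succ_mk]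
    congr 1
    push_cast
    refine sum_congr rfl fun k _ => ?_
    simp [Nat.Partition.countRestricted_two, Nat.Partition.restricted]

lemma coeff_truncSeries_le (n M : ℕ) : coeff n (truncSeries M) ≤ pbar n :=
  (coeff_truncSeries_mono n).ge_of_tendsto (tendsto_coeff_truncSeries n) M

end GeneratingFunction

section Theta
open Finset Filter Topology

lemma norm_truncProd_le {q : ℂ} (hq : ‖q‖ < 1) (M : ℕ) :
    ‖truncProd q M‖ ≤ Real.exp (2 / (1 - ‖q‖) ^ 2) := by
  have hr : 0 < 1 - ‖q‖ := by linarith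
  have h1 : ∀ i ∈ range M, ‖(1 + q ^ (i + 1)) * (1 - q ^ (i + 1))⁻¹‖ ≤
      Real.exp (2 / (1 - ‖q‖) * ‖q‖ ^ i) := by
    intro i _
    have hx0 : 0 ≤ ‖q‖ ^ (i + 1) := by positivity
    have hx1 : ‖q‖ ^ (i + 1) ≤ ‖q‖ := pow_le_of_le_one (norm_nonneg _) hq.le (Nat.succ_ne_zero i)
    have hx2 : ‖q‖ ^ (i + 1) ≤ ‖q‖ ^ i := pow_le_pow_of_le_one (norm_nonneg _) hq.le (Nat.le_succ i)
    have hn : ‖1 + q ^ (i + 1)‖ ≤ 1 + ‖q‖ ^ (i + 1) := by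
      simpa using norm_add_le 1 (q ^ (i + 1))
    have hd : 1 - ‖q‖ ^ (i + 1) ≤ ‖1 - q ^ (i + 1)‖ := by
      simpa using norm_sub_norm_le 1 (q ^ (i + 1))
    rw [norm_mul, norm_inv, ← div_eq_mul_inv]
    calc _ ≤ (1 + ‖q‖ ^ (i + 1)) / (1 - ‖q‖ ^ (i + 1)) := by gcongr; linarith
      _ = 2 / (1 - ‖q‖ ^ (i + 1)) * ‖q‖ ^ (i + 1) + 1 := by
        have : 1 - ‖q‖ ^ (i + 1) ≠ 0 := by linarith
        field_simp
        ring
      _ ≤ 2 / (1 - ‖q‖) * ‖q‖ ^ i + 1 := by gcongr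
      _ ≤ _ := Real.add_one_le_exp _
  rw [truncProd, norm_prod]
  refine (prod_le_prod (fun _ _ => norm_nonneg _) h1).trans ?_
  rw [← Real.exp_sum, ← mul_sum]
  refine Real.exp_le_exp.mpr ?_
  have h2 : ∑ i ∈ range M, ‖q‖ ^ i ≤ (1 - ‖q‖)⁻¹ := by
    rw [← tsum_geometric_of_lt_one (norm_nonneg q) hq]
    exact (summable_geometric_of_lt_one (norm_nonneg q) hq).sum_le_tsum _
      fun _ _ => by positivity
  calc _ ≤ 2 / (1 - ‖q‖) * (1 - ‖q‖)⁻¹ := by gcongr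
    _ = _ := by field_simp

lemma summable_pbar_mul_pow {r : ℝ} (h0 : 0 ≤ r) (h1 : r < 1) :
    Summable fun n => (pbar n : ℝ) * r ^ n := by
  refine summable_of_sum_range_le (c := Real.exp (2 / (1 - r) ^ 2))
    (fun n => by positivity) fun K => ?_
  have hn : ‖(r : ℂ)‖ = r := by simp [abs_of_nonneg h0]
  refine le_of_tendsto (tendsto_finsetSum (range K) fun n _ =>
    (tendsto_coeff_truncSeries n).mul_const (r ^ n)) (Eventually.of_forall fun M => ?_)
  obtain ⟨hs, he⟩ := hasEval_truncSeries M (q := r) (by rwa [hn])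
  have hb := norm_truncProd_le (q := r) (by rwa [hn]) M
  rw [hn, ← he] at hb
  have hs' : Summable fun n => PowerSeries.coeff n (truncSeries M) * r ^ n := by
    refine hs.congr fun n => ?_
    rw [norm_mul, norm_pow, hn, Complex.norm_real, Real.norm_of_nonneg (coeff_truncSeries_nonneg M n)]
  have hnn : ∀ n, 0 ≤ PowerSeries.coeff n (truncSeries M) * r ^ n := fun n =>
    mul_nonneg (coeff_truncSeries_nonneg M n) (by positivity)
  refine (hs'.sum_le_tsum _ fun n _ => hnn n).trans (le_trans ?_ hb)
  have : (∑' n, ((PowerSeries.coeff n (truncSeries M) : ℝ) : ℂ) * (r : ℂ) ^ n) =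
      ((∑' n, PowerSeries.coeff n (truncSeries M) * r ^ n : ℝ) : ℂ) := by
    rw [Complex.ofReal_tsum]; simp
  rw [this, Complex.norm_real]
  exact Real.le_norm_self _

/-- The generating function of overpartitions. -/
noncomputable def gen (q : ℂ) : ℂ := ∑' n, (pbar n : ℂ) * q ^ n

lemma tendsto_truncProd {q : ℂ} (hq : ‖q‖ < 1) :
    Tendsto (truncProd q) atTop (𝓝 (gen q)) := by
  have h : truncProd q = fun M =>
      ∑' n, ((PowerSeries.coeff n (truncSeries M) : ℝ) : ℂ) * q ^ n :=
    funext fun M => (hasEval_truncSeries M hq).2.symm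
  rw [h]
  refine tendsto_tsum_of_dominated_convergence (summable_pbar_mul_pow (norm_nonneg q) hq)
    (fun n => ?_) (Eventually.of_forall fun M n => ?_)
  · refine Tendsto.mul_const _ ?_
    have := (Complex.continuous_ofReal.tendsto _).comp (tendsto_coeff_truncSeries n)
    rwa [Complex.ofReal_natCast] at this
  · rw [norm_mul, norm_pow, Complex.norm_real, Real.norm_of_nonneg (coeff_truncSeries_nonneg M n)]
    exact mul_le_mul_of_nonneg_right (coeff_truncSeries_le n M) (by positivity)

lemma truncProd_zero (q : ℂ) : truncProd q 0 = 1 := by simp [truncProd]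

lemma truncProd_succ (q : ℂ) (n : ℕ) :
    truncProd q (n + 1) = truncProd q n * ((1 + q ^ (n + 1)) * (1 - q ^ (n + 1))⁻¹) := by
  rw [truncProd, prod_range_succ]; rfl

lemma pow_ne_one_of_norm_lt {q : ℂ} (hq : ‖q‖ < 1) (n : ℕ) : 1 - q ^ (n + 1) ≠ 0 := by
  intro h
  have h1 : ‖q ^ (n + 1)‖ = 1 := by rw [← sub_eq_zero.mp h, norm_one]
  rw [norm_pow] at h1
  exact (pow_lt_one₀ (norm_nonneg q) hq (Nat.succ_ne_zero n)).ne h1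

lemma one_add_pow_ne_zero {q : ℂ} (hq : ‖q‖ < 1) (n : ℕ) : 1 + q ^ n ≠ 0 := by
  rcases n with _ | n
  · norm_num
  · intro h
    have h1 : ‖q ^ (n + 1)‖ = 1 := by rw [← neg_eq_of_add_eq_zero_right h, norm_neg, norm_one]
    rw [norm_pow] at h1
    exact (pow_lt_one₀ (norm_nonneg q) hq (Nat.succ_ne_zero n)).ne h1

lemma sum_telescope {q : ℂ} (hq : ‖q‖ < 1) (N m : ℕ) :
    ∑ s ∈ range (m + 1), (-1) ^ s * (2 * truncProd q s / (1 + q ^ s)) *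
      (q ^ (s * (N + 1)) * (1 - q ^ N) - q ^ (s * N) * (1 + q ^ N)) =
      2 * (-1) ^ (m + 1) * q ^ ((m + 1) * N) * truncProd q m := by
  induction m with
  | zero => simp [truncProd_zero]; ring
  | succ m ih =>
    rw [sum_range_succ, ih, truncProd_succ]
    have h1 := pow_ne_one_of_norm_lt hq m
    have h2 := one_add_pow_ne_zero hq (m + 1)
    have e1 : q ^ ((m + 1) * (N + 1)) = q ^ ((m + 1) * N) * q ^ (m + 1) := by
      rw [← pow_add]; ring_nf
    have e2 : q ^ ((m + 1 + 1) * N) = q ^ ((m + 1) * N) * q ^ N := by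
      rw [← pow_add]; ring_nf
    rw [e1, e2, pow_succ (-1 : ℂ) (m + 1)]
    field_simp
    ring

/-- A finite form of Gauss's identity for the theta series of squares. -/
lemma finite_gauss {q : ℂ} (hq : ‖q‖ < 1) (n : ℕ) :
    (2 * ∑ s ∈ range (n + 1), (-1) ^ s * q ^ (s ^ 2) - 1) * truncProd q n =
      ∑ s ∈ range (n + 1), (-1) ^ s * (2 * truncProd q s / (1 + q ^ s)) * q ^ (s * (n + 1)) := by
  induction n with
  | zero => norm_num [truncProd_zero]
  | succ n ih =>
    have h1 := pow_ne_one_of_norm_lt hq n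
    have h2 := one_add_pow_ne_zero hq (n + 1)
    have ht := sum_telescope hq (n + 1) n
    have ht' : (∑ s ∈ range (n + 1), (-1) ^ s * (2 * truncProd q s / (1 + q ^ s)) *
        q ^ (s * (n + 1 + 1))) * (1 - q ^ (n + 1)) -
        (∑ s ∈ range (n + 1), (-1) ^ s * (2 * truncProd q s / (1 + q ^ s)) *
        q ^ (s * (n + 1))) * (1 + q ^ (n + 1)) =
        2 * (-1) ^ (n + 1) * q ^ ((n + 1) * (n + 1)) * truncProd q n := by
      rw [← ht, sum_mul, sum_mul, ← sum_sub_distrib]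
      refine sum_congr rfl fun s _ => ?_
      ring
    rw [← ih] at ht'
    rw [sum_range_succ, sum_range_succ (fun s => (-1) ^ s * (2 * truncProd q s / (1 + q ^ s)) *
      q ^ (s * (n + 1 + 1)))]
    set S := ∑ s ∈ range (n + 1), (-1) ^ s * (2 * truncProd q s / (1 + q ^ s)) *
      q ^ (s * (n + 1 + 1)) with hS
    set A := ∑ s ∈ range (n + 1), (-1 : ℂ) ^ s * q ^ (s ^ 2)
    have hS' : S = ((2 * A - 1) * truncProd q n * (1 + q ^ (n + 1)) +
        2 * (-1) ^ (n + 1) * q ^ ((n + 1) * (n + 1)) * truncProd q n) / (1 - q ^ (n + 1)) := by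
      rw [eq_div_iff h1]; linear_combination ht'
    rw [hS', truncProd_succ]
    have e1 : q ^ ((n + 1) * (n + 1 + 1)) = q ^ ((n + 1) ^ 2) * q ^ (n + 1) := by
      rw [← pow_add]; ring_nf
    rw [e1, ← sq]
    field_simp
    ring

lemma tendsto_partial_theta {τ : ℂ} (hτ : 0 < τ.im) :
    Tendsto (fun n : ℕ => 2 * ∑ s ∈ range (n + 1), (-1) ^ s * Complex.exp (π * Complex.I * τ) ^ (s ^ 2) - 1)
      atTop (𝓝 (jacobiTheta₂ (1 / 2) τ)) := by
  have h := (hasSum_jacobiTheta₂_term (1 / 2) hτ).nat_add_neg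
  have h0 : jacobiTheta₂_term 0 (1 / 2) τ = 1 := by simp [jacobiTheta₂_term]
  rw [h0] at h
  have h2 := ((tendsto_add_atTop_iff_nat 1).mpr h.tendsto_sum_nat).sub_const 1
  rw [add_sub_cancel_right] at h2
  refine h2.congr fun n => ?_
  rw [mul_sum]
  congr 1
  refine sum_congr rfl fun s _ => ?_
  have e1 : jacobiTheta₂_term s (1 / 2) τ =
      (-1) ^ s * Complex.exp (π * Complex.I * τ) ^ (s ^ 2) := by
    rw [jacobiTheta₂_term, Complex.exp_add, ← Complex.exp_nat_mul, ← Complex.exp_pi_mul_I,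
      ← Complex.exp_nat_mul]
    push_cast
    ring_nf
  have e2 : jacobiTheta₂_term (-s) (1 / 2) τ =
      (-1) ^ s * Complex.exp (π * Complex.I * τ) ^ (s ^ 2) := by
    have : ((-1 : ℂ)) ^ s = ((-1) ^ s)⁻¹ := by rw [← inv_pow]; norm_num
    rw [jacobiTheta₂_term, Complex.exp_add, ← Complex.exp_nat_mul, this, ← Complex.exp_pi_mul_I,
      ← Complex.exp_nat_mul, ← Complex.exp_neg]
    push_cast
    ring_nf
  rw [e1, e2]
  ring

/-- Gauss: the generating function of overpartitions is the inverse of a theta function. -/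
theorem gen_mul_theta {τ : ℂ} (hτ : 0 < τ.im) :
    gen (Complex.exp (π * Complex.I * τ)) * jacobiTheta₂ (1 / 2) τ = 1 := by
  set q := Complex.exp (π * Complex.I * τ) with hqdef
  have hq : ‖q‖ < 1 := by
    rw [hqdef, Complex.norm_exp]
    simp [Real.pi_pos, hτ]
  have h1 := (tendsto_partial_theta hτ).mul (tendsto_truncProd hq)
  rw [← hqdef] at h1
  simp_rw [finite_gauss hq] at h1
  rw [mul_comm] at h1
  refine tendsto_nhds_unique h1 ?_
  rw [tendsto_iff_norm_sub_tendsto_zero]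
  have hr : 0 < 1 - ‖q‖ := by linarith
  set B := Real.exp (2 / (1 - ‖q‖) ^ 2)
  refine squeeze_zero (g := fun n => 2 * B / (1 - ‖q‖) * (1 - ‖q‖)⁻¹ * ‖q‖ ^ (n + 1))
    (fun _ => norm_nonneg _) (fun n => ?_) ?_
  · rw [sum_range_succ']
    simp only [pow_zero, truncProd_zero, zero_mul]
    rw [show (1 : ℂ) * (2 * 1 / (1 + 1)) * 1 = 1 by norm_num, add_sub_cancel_right]
    refine (norm_sum_le _ _).trans ?_
    have : ∀ s ∈ range n, ‖(-1) ^ (s + 1) * (2 * truncProd q (s + 1) / (1 + q ^ (s + 1))) *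
        q ^ ((s + 1) * (n + 1))‖ ≤ 2 * B / (1 - ‖q‖) * ‖q‖ ^ (n + 1) * ‖q‖ ^ s := by
      intro s _
      have hd : 1 - ‖q‖ ≤ ‖1 + q ^ (s + 1)‖ := by
        have h3 := norm_sub_norm_le 1 (-q ^ (s + 1))
        rw [norm_neg, norm_pow, norm_one, sub_neg_eq_add] at h3
        have : ‖q‖ ^ (s + 1) ≤ ‖q‖ := pow_le_of_le_one (norm_nonneg _) hq.le (Nat.succ_ne_zero s)
        linarith
      have hp : ‖q‖ ^ ((s + 1) * (n + 1)) ≤ ‖q‖ ^ (n + 1) * ‖q‖ ^ s := by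
        rw [← pow_add]
        exact pow_le_pow_of_le_one (norm_nonneg _) hq.le (by nlinarith)
      simp only [norm_mul, norm_pow, norm_neg, norm_one, one_pow, one_mul, norm_div]
      rw [mul_assoc _ (‖q‖ ^ (n + 1))]
      gcongr
      · simp
      · exact norm_truncProd_le hq _
    refine (sum_le_sum this).trans ?_
    rw [← mul_sum]
    have h2 : ∑ i ∈ range n, ‖q‖ ^ i ≤ (1 - ‖q‖)⁻¹ := by
      rw [← tsum_geometric_of_lt_one (norm_nonneg q) hq]
      exact (summable_geometric_of_lt_one (norm_nonneg q) hq).sum_le_tsum _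
        fun _ _ => by positivity
    calc _ ≤ 2 * B / (1 - ‖q‖) * ‖q‖ ^ (n + 1) * (1 - ‖q‖)⁻¹ := by gcongr
      _ = _ := by ring
  · have := ((tendsto_add_atTop_iff_nat 1).mpr
      (tendsto_pow_atTop_nhds_zero_of_lt_one (norm_nonneg q) hq)).const_mul
        (2 * B / (1 - ‖q‖) * (1 - ‖q‖)⁻¹)
    simpa using this

end Theta

section Bounds
open Finset Filter Topology

lemma hasSum_log_div {z : ℂ} (hz : ‖z‖ < 1) :
    HasSum (fun n : ℕ => ((((-1) ^ (n + 1) + 1) / n : ℝ) : ℂ) * z ^ n)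
      (Complex.log (1 + z) - Complex.log (1 - z)) := by
  have h := (Complex.hasSum_taylorSeries_log hz).add (Complex.hasSum_taylorSeries_neg_log hz)
  rw [← sub_eq_add_neg] at h
  refine h.congr_fun fun n => ?_
  push_cast
  ring

lemma exp_log_div {z : ℂ} (hz : ‖z‖ < 1) :
    ‖(1 + z) * (1 - z)⁻¹‖ =
      Real.exp ((Complex.log (1 + z) - Complex.log (1 - z)).re) := by
  have h1 : 1 + z ≠ 0 := by
    intro h
    rw [← neg_eq_of_add_eq_zero_right h, norm_neg, norm_one] at hz
    exact lt_irrefl _ hz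
  have h2 : 1 - z ≠ 0 := by
    intro h
    rw [← sub_eq_zero.mp h, norm_one] at hz
    exact lt_irrefl _ hz
  rw [← Complex.norm_exp, Complex.exp_sub, Complex.exp_log h1, Complex.exp_log h2, div_eq_mul_inv]

lemma norm_factor_le {z : ℂ} (hz : ‖z‖ < 1) :
    ‖(1 + z) * (1 - z)⁻¹‖ ≤ ‖(1 + (‖z‖ : ℂ)) * (1 - (‖z‖ : ℂ))⁻¹‖ *
      Real.exp (2 * z.re - 2 * ‖z‖) := by
  have hz' : ‖(‖z‖ : ℂ)‖ < 1 := by simpa using hz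
  rw [exp_log_div hz, exp_log_div hz', ← Real.exp_add, Real.exp_le_exp]
  have h1 := Complex.hasSum_re (hasSum_log_div hz)
  have h2 := Complex.hasSum_re (hasSum_log_div hz')
  have h := h2.sub h1
  have hterm : ∀ n : ℕ, ((((((-1) ^ (n + 1) + 1) / n : ℝ) : ℂ) * (‖z‖ : ℂ) ^ n).re -
      (((((-1) ^ (n + 1) + 1) / n : ℝ) : ℂ) * z ^ n).re) =
      ((-1) ^ (n + 1) + 1) / n * (‖z‖ ^ n - (z ^ n).re) := by
    intro n
    rw [Complex.re_ofReal_mul, Complex.re_ofReal_mul, ← Complex.ofReal_pow, Complex.ofReal_re]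
    ring
  simp_rw [hterm] at h
  have hle := le_hasSum h 1 fun n _ => by
    have h3 : (z ^ n).re ≤ ‖z‖ ^ n := by
      rw [← norm_pow]; exact Complex.re_le_norm _
    have h4 : (0 : ℝ) ≤ (-1) ^ (n + 1) + 1 := by
      rcases neg_one_pow_eq_or ℝ (n + 1) with h | h <;> rw [h] <;> norm_num
    exact mul_nonneg (div_nonneg h4 (Nat.cast_nonneg n)) (by linarith)
  norm_num at hle
  simp only [Complex.sub_re]
  linarith

lemma norm_gen_le {q : ℂ} (hq : ‖q‖ < 1) :
    ‖gen q‖ ≤ ‖gen (‖q‖ : ℂ)‖ *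
      Real.exp (2 * (1 - q)⁻¹.re - 2 * (1 - ‖q‖)⁻¹) := by
  have hq' : ‖(‖q‖ : ℂ)‖ < 1 := by simpa using hq
  have hfin : ∀ M, ‖truncProd q M‖ ≤ ‖truncProd (‖q‖ : ℂ) M‖ *
      Real.exp (2 * (∑ i ∈ range M, q ^ (i + 1)).re - 2 * ∑ i ∈ range M, ‖q‖ ^ (i + 1)) := by
    intro M
    rw [Complex.re_sum, mul_sum, mul_sum, ← sum_sub_distrib, Real.exp_sum, truncProd, truncProd,
      norm_prod, norm_prod, ← prod_mul_distrib]
    refine prod_le_prod (fun _ _ => norm_nonneg _) fun i _ => ?_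
    have := norm_factor_le (z := q ^ (i + 1)) (by
      rw [norm_pow]; exact pow_lt_one₀ (norm_nonneg q) hq (Nat.succ_ne_zero i))
    simpa [norm_pow] using this
  have h1 : Tendsto (fun M => ∑ i ∈ range M, q ^ (i + 1)) atTop (𝓝 ((1 - q)⁻¹ - 1)) := by
    have h := ((tendsto_add_atTop_iff_nat 1).mpr
      (hasSum_geometric_of_norm_lt_one hq).tendsto_sum_nat).sub_const 1
    refine h.congr fun n => ?_
    rw [sum_range_succ']
    simp
  have h2 : Tendsto (fun M => ∑ i ∈ range M, ‖q‖ ^ (i + 1)) atTop (𝓝 ((1 - ‖q‖)⁻¹ - 1)) := by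
    have h := ((tendsto_add_atTop_iff_nat 1).mpr
      (hasSum_geometric_of_lt_one (norm_nonneg q) hq).tendsto_sum_nat).sub_const 1
    refine h.congr fun n => ?_
    rw [sum_range_succ']
    simp
  have hre := (Complex.continuous_re.tendsto _).comp h1
  have hlim := le_of_tendsto_of_tendsto' (tendsto_truncProd hq).norm
    ((tendsto_truncProd hq').norm.mul
      ((Real.continuous_exp.tendsto _).comp ((hre.const_mul 2).sub (h2.const_mul 2)))) hfin
  refine hlim.trans (le_of_eq ?_)
  congr 2
  simp
  ring

/-- The theta factor after the modular transformation. -/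
noncomputable def thetaTail (t : ℂ) : ℂ := ∑' n : ℕ, Complex.exp (-(π ^ 2 * (n + 1) * (n + 2) / t))

lemma norm_thetaTail_le {t : ℂ} (ht : 0 < t.re) :
    ‖thetaTail t‖ ≤ Real.exp (-(2 * π ^ 2 * t⁻¹.re)) * (1 - Real.exp (-(2 * π ^ 2 * t⁻¹.re)))⁻¹ := by
  have hx : 0 < t⁻¹.re := by
    rw [Complex.inv_re]
    exact div_pos ht (Complex.normSq_pos.mpr fun h => by simp [h] at ht)
  set x := t⁻¹.re
  set ρ := Real.exp (-(2 * π ^ 2 * x)) with hρ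
  have hρ1 : ρ < 1 := by
    rw [hρ, Real.exp_lt_one_iff]
    have := Real.pi_pos
    have : 0 < 2 * π ^ 2 * x := by positivity
    linarith
  have hρ0 : 0 < ρ := Real.exp_pos _
  have hg := (hasSum_geometric_of_lt_one hρ0.le hρ1).mul_left ρ
  refine tsum_of_norm_bounded hg fun n => ?_
  rw [Complex.norm_exp]
  have : (-((π : ℂ) ^ 2 * (n + 1) * (n + 2) / t)).re = -(π ^ 2 * (n + 1) * (n + 2) * x) := by
    rw [div_eq_mul_inv, show ((π : ℂ) ^ 2 * (n + 1) * (n + 2)) =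
      ((π ^ 2 * (n + 1) * (n + 2) : ℝ) : ℂ) by push_cast; ring, Complex.neg_re,
      Complex.re_ofReal_mul]
  rw [this, hρ, ← Real.exp_nat_mul, ← Real.exp_add, Real.exp_le_exp]
  have hn : (0 : ℝ) ≤ n := Nat.cast_nonneg n
  have h1 : 0 ≤ π ^ 2 * x * (n * (n + 1)) := by positivity
  nlinarith

lemma jacobiTheta₂_dual {t : ℂ} (ht : 0 < t.re) :
    jacobiTheta₂ (1 / 2 / (Complex.I * t / π)) (-1 / (Complex.I * t / π)) =
      2 * (1 + thetaTail t) := by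
  have ht0 : t ≠ 0 := fun h => by simp [h] at ht
  have hπ : (π : ℂ) ≠ 0 := Complex.ofReal_ne_zero.mpr Real.pi_ne_zero
  have him : 0 < (-1 / (Complex.I * t / π)).im := by
    have : -1 / (Complex.I * t / π) = Complex.I * (π * t⁻¹) := by
      field_simp
      rw [Complex.I_sq]
    rw [this, Complex.I_mul_im, Complex.re_ofReal_mul, Complex.inv_re]
    exact mul_pos Real.pi_pos (div_pos ht (Complex.normSq_pos.mpr ht0))
  have hs := (hasSum_jacobiTheta₂_term (1 / 2 / (Complex.I * t / π)) him)
  have hterm : ∀ n : ℤ, jacobiTheta₂_term n (1 / 2 / (Complex.I * t / π))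
      (-1 / (Complex.I * t / π)) = Complex.exp (-(π ^ 2 * (n * (n - 1)) / t)) := by
    intro n
    rw [jacobiTheta₂_term]
    congr 1
    field_simp
    ring
  simp_rw [hterm] at hs
  have hnat := hs.summable.comp_injective (Nat.cast_injective (R := ℤ))
  have hneg := hs.summable.comp_injective (i := fun n : ℕ => -((n : ℤ) + 1)) (fun a b h => by
    simpa using h)
  have h := hnat.hasSum.of_nat_of_neg_add_one (f := fun n : ℤ =>
    Complex.exp (-(π ^ 2 * (n * (n - 1)) / t))) hneg.hasSum
  rw [hs.unique h, hnat.tsum_eq_zero_add, ((summable_nat_add_iff 1).mpr hnat).tsum_eq_zero_add]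
  have e1 : ∀ n : ℕ, ((fun n : ℤ => Complex.exp (-(π ^ 2 * (n * (n - 1)) / t))) ∘ Nat.cast)
      (n + 1 + 1) = Complex.exp (-(π ^ 2 * (n + 1) * (n + 2) / t)) := by
    intro n
    simp only [Function.comp]
    congr 1
    push_cast
    ring
  have e2 : ∀ n : ℕ, ((fun n : ℤ => Complex.exp (-(π ^ 2 * (n * (n - 1)) / t))) ∘
      fun n : ℕ => -((n : ℤ) + 1)) n = Complex.exp (-(π ^ 2 * (n + 1) * (n + 2) / t)) := by
    intro n
    simp only [Function.comp]
    congr 1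
    push_cast
    ring
  rw [tsum_congr e1, tsum_congr e2, ← thetaTail]
  simp
  ring

/-- Exact modular transformation of the generating function of overpartitions. -/
lemma gen_mul_one_add {t : ℂ} (ht : 0 < t.re) :
    gen (Complex.exp (-t)) * (1 + thetaTail t) =
      (1 / 2) * (t / π) ^ (1 / 2 : ℂ) * Complex.exp (π ^ 2 / 4 * t⁻¹) := by
  have ht0 : t ≠ 0 := fun h => by simp [h] at ht
  have hπ : (π : ℂ) ≠ 0 := Complex.ofReal_ne_zero.mpr Real.pi_ne_zero
  have him : 0 < (Complex.I * t / π).im := by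
    rw [Complex.div_ofReal_im, Complex.I_mul_im]
    exact div_pos ht Real.pi_pos
  have h := gen_mul_theta him
  have e1 : π * Complex.I * (Complex.I * t / π) = -t := by
    field_simp
    rw [Complex.I_sq]
  have e2 : -Complex.I * (Complex.I * t / π) = t / π := by
    rw [← mul_div_assoc, ← mul_assoc, neg_mul, Complex.I_mul_I]; ring
  have e3 : -π * Complex.I * (1 / 2) ^ 2 / (Complex.I * t / π) = -(π ^ 2 / 4 * t⁻¹) := by
    field_simp
    ring
  rw [jacobiTheta₂_functional_equation, jacobiTheta₂_dual ht, e1, e2, e3, Complex.exp_neg (_ * _)] at h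
  have hp : (t / π) ^ (1 / 2 : ℂ) ≠ 0 := by
    rw [Ne, Complex.cpow_eq_zero_iff]
    simp [ht0, hπ]
  have he := Complex.exp_ne_zero (π ^ 2 / 4 * t⁻¹)
  field_simp at h ⊢
  linear_combination h

lemma gen_approx {t : ℂ} (ht : 0 < t.re) (hρ : Real.exp (-(2 * π ^ 2 * t⁻¹.re)) ≤ 1 / 4) :
    ‖gen (Complex.exp (-t)) - (1 / 2) * (t / π) ^ (1 / 2 : ℂ) * Complex.exp (π ^ 2 / 4 * t⁻¹)‖ ≤
      ‖(t / π) ^ (1 / 2 : ℂ)‖ * Real.exp (π ^ 2 / 4 * t⁻¹.re) *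
        Real.exp (-(2 * π ^ 2 * t⁻¹.re)) := by
  have h1 := gen_mul_one_add ht
  have h2 := norm_thetaTail_le ht
  set ρ := Real.exp (-(2 * π ^ 2 * t⁻¹.re))
  set ε := thetaTail t
  have hρ0 : 0 < ρ := Real.exp_pos _
  have h3 : ‖ε‖ ≤ 4 / 3 * ρ := by
    refine h2.trans ?_
    rw [mul_comm]
    gcongr
    rw [inv_le_comm₀ (by linarith) (by norm_num)]
    linarith
  set A := (1 / 2) * (t / π) ^ (1 / 2 : ℂ) * Complex.exp (π ^ 2 / 4 * t⁻¹) with hA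
  have h4 : 2 / 3 ≤ ‖1 + ε‖ := by
    have := norm_sub_norm_le 1 (-ε)
    rw [norm_neg, norm_one, sub_neg_eq_add] at this
    linarith
  have h5 : (gen (Complex.exp (-t)) - A) * (1 + ε) = -A * ε := by
    rw [sub_mul, h1]; ring
  have h6 := congrArg norm h5
  rw [norm_mul, norm_mul, norm_neg] at h6
  have hAn : ‖A‖ = 1 / 2 * ‖(t / π) ^ (1 / 2 : ℂ)‖ * Real.exp (π ^ 2 / 4 * t⁻¹.re) := by
    rw [hA, norm_mul, norm_mul, Complex.norm_exp, show ((π : ℂ) ^ 2 / 4) = ((π ^ 2 / 4 : ℝ) : ℂ) by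
      push_cast; ring, Complex.re_ofReal_mul]
    norm_num
  have h7 : ‖gen (Complex.exp (-t)) - A‖ * (2 / 3) ≤ ‖A‖ * (4 / 3 * ρ) := by
    calc _ ≤ ‖gen (Complex.exp (-t)) - A‖ * ‖1 + ε‖ := by gcongr
      _ = ‖A‖ * ‖ε‖ := h6
      _ ≤ _ := by gcongr
  have h8 : ‖(t / π) ^ (1 / 2 : ℂ)‖ * Real.exp (π ^ 2 / 4 * t⁻¹.re) = 2 * ‖A‖ := by
    rw [hAn]; ring
  rw [h8]
  linarith

end Bounds

section MainIntegral
open Set Filter Topology MeasureTheory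

lemma exists_primitive_exp_sq : ∃ F : ℂ → ℂ, ∀ z, HasDerivAt F (Complex.exp (z ^ 2)) z := by
  have h : Differentiable ℂ fun z : ℂ => Complex.exp (z ^ 2) := by fun_prop
  obtain ⟨F, hF⟩ := h.isExactOn_univ
  exact ⟨F, fun z => hF z (mem_univ z)⟩

lemma norm_primitive_sub_le {F : ℂ → ℂ} (hF : ∀ z, HasDerivAt F (Complex.exp (z ^ 2)) z)
    {a b : ℂ} {C : ℝ} (hC : ∀ z ∈ segment ℝ a b, (z ^ 2).re ≤ C) :
    ‖F b - F a‖ ≤ Real.exp C * ‖b - a‖ := by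
  refine Convex.norm_image_sub_le_of_norm_hasDerivWithin_le (s := segment ℝ a b)
    (f' := fun z => Complex.exp (z ^ 2)) (fun z _ => (hF z).hasDerivWithinAt) (fun z hz => ?_)
    (convex_segment a b) (left_mem_segment ℝ a b) (right_mem_segment ℝ a b)
  rw [Complex.norm_exp]
  exact Real.exp_le_exp.2 (hC z hz)

lemma abs_integral_gaussian_sub_le {σ : ℝ} (hσ : 0 ≤ σ) :
    |(∫ x in (-σ)..σ, Real.exp (-x ^ 2)) - √π| ≤ √π * Real.exp (-σ ^ 2) := by
  have hgint : Integrable fun x : ℝ => Real.exp (-x ^ 2) := by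
    simpa using integrable_exp_neg_mul_sq (b := 1) one_pos
  have hI : ∫ x in Ioi (0 : ℝ), Real.exp (-x ^ 2) = √π / 2 := by
    simpa using integral_gaussian_Ioi 1
  have hsplit := intervalIntegral.integral_interval_add_Ioi (a := 0) (b := σ)
    hgint.integrableOn hgint.integrableOn
  have htail0 : 0 ≤ ∫ x in Ioi σ, Real.exp (-x ^ 2) :=
    setIntegral_nonneg measurableSet_Ioi fun x _ => (Real.exp_pos _).le
  have hshift : ∫ x in Ioi (0 : ℝ), Real.exp (-(x + σ) ^ 2) = ∫ x in Ioi σ, Real.exp (-x ^ 2) := by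
    have := (measurePreserving_add_right volume σ).setIntegral_preimage_emb
      (measurableEmbedding_addRight σ) (fun x : ℝ => Real.exp (-x ^ 2)) (Ioi σ)
    simpa using this
  have htail : ∫ x in Ioi σ, Real.exp (-x ^ 2) ≤ Real.exp (-σ ^ 2) * (√π / 2) := by
    rw [← hshift, ← hI, ← integral_const_mul]
    refine setIntegral_mono_on (hgint.comp_add_right σ).integrableOn
      (hgint.const_mul _).integrableOn measurableSet_Ioi fun x hx => ?_
    rw [← Real.exp_add]
    have : 0 ≤ x * σ := mul_nonneg (le_of_lt hx) hσ
    exact Real.exp_le_exp.2 (by nlinarith)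
  have hsymm : ∫ x in (-σ)..σ, Real.exp (-x ^ 2) = 2 * ∫ x in (0 : ℝ)..σ, Real.exp (-x ^ 2) := by
    rw [← intervalIntegral.integral_add_adjacent_intervals (b := 0)
      hgint.intervalIntegrable hgint.intervalIntegrable]
    have := intervalIntegral.integral_comp_neg (a := 0) (b := σ) fun x : ℝ => Real.exp (-x ^ 2)
    simp only [neg_sq, neg_zero] at this
    rw [← this]
    ring
  rw [hI] at hsplit
  rw [hsymm, abs_le]
  constructor <;> linarith [mul_nonneg (Real.exp_pos (-σ ^ 2)).le (Real.sqrt_nonneg π)]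

lemma primitive_vertical {F : ℂ → ℂ} (hF : ∀ z, HasDerivAt F (Complex.exp (z ^ 2)) z) (σ : ℝ) :
    F (σ * Complex.I) - F (-(σ * Complex.I)) =
      Complex.I * ((∫ x in (-σ)..σ, Real.exp (-x ^ 2) : ℝ) : ℂ) := by
  have hd : ∀ x : ℝ, HasDerivAt (fun y : ℝ => F (y * Complex.I))
      (Complex.I * (Real.exp (-x ^ 2) : ℂ)) x := fun x => by
    have h1 : HasDerivAt (fun y : ℝ => (y : ℂ) * Complex.I) Complex.I x := by
      simpa using (Complex.ofRealCLM.hasDerivAt (x := x)).mul_const Complex.I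
    have h2 := (hF (x * Complex.I)).comp x h1
    refine h2.congr_deriv ?_
    rw [mul_pow, Complex.I_sq, mul_comm]
    push_cast
    ring_nf
  have := intervalIntegral.integral_eq_sub_of_hasDerivAt (a := -σ) (b := σ) (fun x _ => hd x)
    (Continuous.intervalIntegrable (by fun_prop) _ _)
  rw [intervalIntegral.integral_const_mul, intervalIntegral.integral_ofReal] at this
  rw [this]
  push_cast
  ring_nf

/-- An antiderivative of `t ^ (1/2) * exp (b² / t + N² t)` built from a primitive `F` of
`exp (z²)`. -/
noncomputable def saddlePrimitive (F : ℂ → ℂ) (N b : ℝ) (t : ℂ) : ℂ :=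
  ((N : ℂ) ^ 2)⁻¹ * (t ^ (2⁻¹ : ℂ) * Complex.exp (b ^ 2 / t + N ^ 2 * t)
    + (b - 1 / (2 * N)) * Complex.exp (2 * N * b) * F (N * t ^ (2⁻¹ : ℂ) - b / t ^ (2⁻¹ : ℂ))
    - (b + 1 / (2 * N)) * Complex.exp (-(2 * N * b)) * F (N * t ^ (2⁻¹ : ℂ) + b / t ^ (2⁻¹ : ℂ)))

lemma hasDerivAt_saddlePrimitive {F : ℂ → ℂ} (hF : ∀ z, HasDerivAt F (Complex.exp (z ^ 2)) z)
    {N b : ℝ} (hN : N ≠ 0) {t : ℂ} (ht : 0 < t.re) :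
    HasDerivAt (saddlePrimitive F N b)
      (t ^ (2⁻¹ : ℂ) * Complex.exp (b ^ 2 / t + N ^ 2 * t)) t := by
  have ht0 : t ≠ 0 := fun h => by simp [h] at ht
  have hN' : (N : ℂ) ≠ 0 := by exact_mod_cast hN
  have hsq : (t ^ (2⁻¹ : ℂ)) ^ 2 = t := by
    simp
  have hs0 : t ^ (2⁻¹ : ℂ) ≠ 0 := fun h => ht0 (by rw [← hsq, h]; simp)
  have hs : HasDerivAt (fun z : ℂ => z ^ (2⁻¹ : ℂ)) (1 / (2 * t ^ (2⁻¹ : ℂ))) t := by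
    have h := (hasDerivAt_id t).cpow_const (c := 2⁻¹) (Or.inl ht)
    refine h.congr_deriv ?_
    have h1 : t ^ ((2⁻¹ : ℂ) - 1) = t ^ (2⁻¹ : ℂ) / (t ^ (2⁻¹ : ℂ)) ^ 2 := by
      rw [Complex.cpow_sub _ _ ht0, Complex.cpow_one, hsq]
    simp only [id, h1]
    field_simp
  have hE : HasDerivAt (fun z : ℂ => Complex.exp (b ^ 2 / z + N ^ 2 * z))
      (Complex.exp (b ^ 2 / t + N ^ 2 * t) * (-(b ^ 2 / t ^ 2) + N ^ 2)) t := by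
    refine HasDerivAt.cexp ?_
    have h1 := ((hasDerivAt_inv ht0).const_mul ((b : ℂ) ^ 2)).add
      ((hasDerivAt_id t).const_mul ((N : ℂ) ^ 2))
    refine (h1.congr_deriv ?_).congr_of_eventuallyEq (Eventually.of_forall fun z => ?_)
    · simp [div_eq_mul_inv]
    · simp [div_eq_mul_inv]
  have hinv := hs.inv hs0
  have hv := (hs.const_mul (N : ℂ)).sub (hinv.const_mul (b : ℂ))
  have hw := (hs.const_mul (N : ℂ)).add (hinv.const_mul (b : ℂ))
  have hFv := (hF _).comp t hv
  have hFw := (hF _).comp t hw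
  have hmain := (((hs.mul hE).add (hFv.const_mul ((b - 1 / (2 * N)) * Complex.exp (2 * N * b)))).sub
    (hFw.const_mul ((b + 1 / (2 * N)) * Complex.exp (-(2 * N * b))))).const_mul ((N : ℂ) ^ 2)⁻¹
  have hfun : saddlePrimitive F N b = _ := rfl
  refine (hmain.congr_deriv ?_).congr_of_eventuallyEq (Eventually.of_forall fun z => ?_)
  · set s := t ^ (2⁻¹ : ℂ) with hsdef
    have e1 : Complex.exp (2 * N * b) * Complex.exp ((N * s - b * s⁻¹) ^ 2)
        = Complex.exp (b ^ 2 / t + N ^ 2 * t) := by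
      rw [← Complex.exp_add, ← hsq]
      congr 1
      field_simp
      ring
    have e2 : Complex.exp (-(2 * N * b)) * Complex.exp ((N * s + b * s⁻¹) ^ 2)
        = Complex.exp (b ^ 2 / t + N ^ 2 * t) := by
      rw [← Complex.exp_add, ← hsq]
      congr 1
      field_simp
      ring
    simp only [Pi.inv_apply, Pi.sub_apply, Pi.add_apply]
    generalize hA : Complex.exp ((N * s - b * s⁻¹) ^ 2) = A at e1 ⊢
    generalize hB : Complex.exp ((N * s + b * s⁻¹) ^ 2) = B at e2 ⊢
    generalize Complex.exp (2 * N * b) = P at e1 ⊢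
    generalize Complex.exp (-(2 * N * b)) = Q at e2 ⊢
    generalize Complex.exp (b ^ 2 / t + N ^ 2 * t) = E at e1 e2 ⊢
    have hp : ∀ x y : ℂ, (b - 1 / (2 * N)) * P * (A * x) = (b - 1 / (2 * N)) * E * x := fun x y => by
      rw [← e1]; ring
    have hq : ∀ x y : ℂ, (b + 1 / (2 * N)) * Q * (B * x) = (b + 1 / (2 * N)) * E * x := fun x y => by
      rw [← e2]; ring
    rw [hp _ 0, hq _ 0, ← hsq]
    field_simp
    ring
  · simp [saddlePrimitive, div_eq_mul_inv]

end MainIntegral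

section MainIntegralBound
open Set Filter Topology MeasureTheory

lemma norm_primitive_horizontal_le {F : ℂ → ℂ} (hF : ∀ z, HasDerivAt F (Complex.exp (z ^ 2)) z)
    (x σ : ℝ) :
    ‖F ⟨x, σ⟩ - F ⟨0, σ⟩‖ ≤ Real.exp (x ^ 2 - σ ^ 2) * |x| := by
  have h := norm_primitive_sub_le hF (a := ⟨0, σ⟩) (b := ⟨x, σ⟩) (C := x ^ 2 - σ ^ 2) ?_
  · have e : (⟨x, σ⟩ : ℂ) - ⟨0, σ⟩ = (x : ℂ) := by apply Complex.ext <;> simp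
    rwa [e, Complex.norm_real, Real.norm_eq_abs] at h
  · rintro z hz
    rw [segment_eq_image_lineMap] at hz
    obtain ⟨θ, ⟨h0, h1⟩, rfl⟩ := hz
    simp only [AffineMap.lineMap_apply_module, Complex.real_smul, pow_two, Complex.add_re,
      Complex.mul_re, Complex.add_im, Complex.mul_im, Complex.ofReal_re, Complex.ofReal_im]
    have : θ ^ 2 * x ^ 2 ≤ x ^ 2 := mul_le_of_le_one_left (sq_nonneg x) (pow_le_one₀ h0 h1)
    nlinarith

lemma norm_primitive_conj_sub_le {F : ℂ → ℂ} (hF : ∀ z, HasDerivAt F (Complex.exp (z ^ 2)) z)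
    (x σ : ℝ) :
    ‖F ⟨x, σ⟩ - F ⟨x, -σ⟩‖ ≤ Real.exp (x ^ 2) * (2 * |σ|) := by
  have h := norm_primitive_sub_le hF (a := ⟨x, -σ⟩) (b := ⟨x, σ⟩) (C := x ^ 2) ?_
  · have e : (⟨x, σ⟩ : ℂ) - ⟨x, -σ⟩ = (2 * σ : ℝ) * Complex.I := by
      apply Complex.ext <;> simp; ring
    rwa [e, norm_mul, Complex.norm_I, mul_one, Complex.norm_real, Real.norm_eq_abs, abs_mul,
      abs_two] at h
  · rintro z hz
    rw [segment_eq_image_lineMap] at hz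
    obtain ⟨θ, ⟨h0, h1⟩, rfl⟩ := hz
    simp only [AffineMap.lineMap_apply_module, Complex.real_smul, pow_two, Complex.add_re,
      Complex.mul_re, Complex.add_im, Complex.mul_im, Complex.ofReal_re, Complex.ofReal_im]
    nlinarith [sq_nonneg ((1 - θ) * -σ + θ * σ)]

/-- The primitive of `exp (z²)` increases by `I √π` between conjugate points, up to an
exponentially small error. -/
lemma norm_primitive_conj_sub_sub_le {F : ℂ → ℂ}
    (hF : ∀ z, HasDerivAt F (Complex.exp (z ^ 2)) z) {x σ : ℝ} (hσ : 0 ≤ σ) :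
    ‖F ⟨x, σ⟩ - F ⟨x, -σ⟩ - Complex.I * (√π : ℝ)‖ ≤
      Real.exp (x ^ 2 - σ ^ 2) * (2 * |x| + √π) := by
  have h1 := norm_primitive_horizontal_le hF x σ
  have h2 := norm_primitive_horizontal_le hF x (-σ)
  have h3 := primitive_vertical hF σ
  have e1 : (σ : ℂ) * Complex.I = ⟨0, σ⟩ := by apply Complex.ext <;> simp
  have e2 : -((σ : ℂ) * Complex.I) = ⟨0, -σ⟩ := by apply Complex.ext <;> simp
  rw [e2, e1] at h3
  have h4 : ‖F ⟨0, σ⟩ - F ⟨0, -σ⟩ - Complex.I * (√π : ℝ)‖ ≤ √π * Real.exp (x ^ 2 - σ ^ 2) := by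
    rw [h3, ← mul_sub, norm_mul, Complex.norm_I, one_mul, ← Complex.ofReal_sub, Complex.norm_real,
      Real.norm_eq_abs]
    refine (abs_integral_gaussian_sub_le hσ).trans ?_
    gcongr
    nlinarith [sq_nonneg x]
  rw [neg_sq] at h2
  have e : F ⟨x, σ⟩ - F ⟨x, -σ⟩ - Complex.I * (√π : ℝ) =
      (F ⟨x, σ⟩ - F ⟨0, σ⟩) - (F ⟨x, -σ⟩ - F ⟨0, -σ⟩) +
        (F ⟨0, σ⟩ - F ⟨0, -σ⟩ - Complex.I * (√π : ℝ)) := by ring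
  rw [e]
  refine (norm_add_le _ _).trans ((add_le_add (norm_sub_le _ _) le_rfl).trans ?_)
  linarith

lemma continuous_model {t₀ : ℝ} (ht0 : 0 < t₀) (N b : ℝ) :
    Continuous fun y : ℝ => ((t₀ : ℂ) + y * Complex.I) ^ (2⁻¹ : ℂ) *
      Complex.exp ((b : ℂ) ^ 2 / (t₀ + y * Complex.I) + (N : ℂ) ^ 2 * (t₀ + y * Complex.I)) := by
  have hre : ∀ y : ℝ, ((t₀ : ℂ) + y * Complex.I).re = t₀ := fun y => by simp
  have h0 : ∀ y : ℝ, (t₀ : ℂ) + y * Complex.I ≠ 0 := fun y h => by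
    have := congrArg Complex.re h
    rw [hre, Complex.zero_re] at this
    exact ht0.ne' this
  refine Continuous.mul (Continuous.cpow (by fun_prop) continuous_const fun y => ?_) ?_
  · exact Or.inl (by rw [hre]; exact ht0)
  · exact Complex.continuous_exp.comp
      ((continuous_const.div (by fun_prop) h0).add (by fun_prop))

set_option maxHeartbeats 1000000 in
lemma norm_main_integral_sub_le {N : ℝ} (hN : 74 ≤ N) :
    ‖(∫ y in (-(2 * (π / 2 / N)))..(2 * (π / 2 / N)),
        ((π / 2 / N : ℝ) + y * Complex.I) ^ (2⁻¹ : ℂ) *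
          Complex.exp (((π / 2 : ℝ) : ℂ) ^ 2 / ((π / 2 / N : ℝ) + y * Complex.I)
            + (N : ℂ) ^ 2 * ((π / 2 / N : ℝ) + y * Complex.I)))
      - ((N ^ 2)⁻¹ * ((π / 2 - 1 / (2 * N)) * Real.exp (π * N) * √π) : ℝ)‖
      ≤ Real.exp (0.7 * π * N) := by
  obtain ⟨F, hF⟩ := exists_primitive_exp_sq
  have hπ3 := Real.pi_gt_three
  have hπ4 : π < 3.15 := Real.pi_lt_d2
  have hN0 : 0 < N := by linarith
  set b : ℝ := π / 2 with hb
  have hb0 : 0 < b := by positivity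
  set t₀ : ℝ := b / N with ht₀
  have ht0 : 0 < t₀ := by positivity
  have hNt : N * t₀ = b := by rw [ht₀]; field_simp
  set t₁ : ℂ := t₀ + (2 * t₀ : ℝ) * Complex.I with ht₁
  have hre : ∀ y : ℝ, ((t₀ : ℂ) + y * Complex.I).re = t₀ := fun y => by simp
  have hconj : (t₀ : ℂ) + (-(2 * t₀) : ℝ) * Complex.I = (starRingEnd ℂ) t₁ := by
    rw [ht₁]; apply Complex.ext <;> simp
  -- the fundamental theorem of calculus
  have hftc : (∫ y in (-(2 * t₀))..(2 * t₀), ((t₀ : ℂ) + y * Complex.I) ^ (2⁻¹ : ℂ) *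
      Complex.exp ((b : ℂ) ^ 2 / (t₀ + y * Complex.I) + (N : ℂ) ^ 2 * (t₀ + y * Complex.I))) =
      -Complex.I * (saddlePrimitive F N b t₁ - saddlePrimitive F N b ((starRingEnd ℂ) t₁)) := by
    have hd : ∀ y : ℝ, HasDerivAt
        (fun y : ℝ => -Complex.I * saddlePrimitive F N b (t₀ + y * Complex.I))
        (((t₀ : ℂ) + y * Complex.I) ^ (2⁻¹ : ℂ) *
          Complex.exp ((b : ℂ) ^ 2 / (t₀ + y * Complex.I) + (N : ℂ) ^ 2 * (t₀ + y * Complex.I)))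
        y := fun y => by
      have h1 : HasDerivAt (fun y : ℝ => (t₀ : ℂ) + (y : ℂ) * Complex.I) Complex.I y := by
        simpa using ((Complex.ofRealCLM.hasDerivAt (x := y)).mul_const Complex.I).const_add (t₀ : ℂ)
      have h2 := (hasDerivAt_saddlePrimitive hF (N := N) (b := b) hN0.ne'
        (t := t₀ + y * Complex.I) (by rw [hre]; exact ht0)).comp y h1
      refine (h2.const_mul (-Complex.I)).congr_deriv ?_
      linear_combination (-(((t₀ : ℂ) + y * Complex.I) ^ (2⁻¹ : ℂ) * Complex.exp ((b : ℂ) ^ 2 /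
        (t₀ + y * Complex.I) + (N : ℂ) ^ 2 * (t₀ + y * Complex.I)))) * Complex.I_sq
    rw [intervalIntegral.integral_eq_sub_of_hasDerivAt (fun y _ => hd y)
      ((continuous_model ht0 N b).intervalIntegrable _ _), hconj, ← mul_sub]
  rw [hftc]
  -- the square root of the endpoint
  set s : ℂ := t₁ ^ (2⁻¹ : ℂ) with hs
  have ht₁re : t₁.re = t₀ := by rw [ht₁, hre]
  have ht₁im : t₁.im = 2 * t₀ := by rw [ht₁]; simp
  have hsconj : ((starRingEnd ℂ) t₁) ^ (2⁻¹ : ℂ) = (starRingEnd ℂ) s := by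
    rw [hs, Complex.conj_cpow t₁ (2⁻¹ : ℂ)]
    · rw [map_inv₀, Complex.conj_ofNat]
    · intro h
      have := (Complex.arg_eq_pi_iff.1 h).1
      rw [ht₁re] at this
      linarith
  have hsq : s ^ 2 = t₁ := by rw [hs]; simp
  have hs0 : s ≠ 0 := fun h => by
    rw [h] at hsq
    have := congrArg Complex.re hsq
    rw [ht₁re] at this
    simp at this
    exact ht0.ne this
  have hsim : 0 ≤ s.im := by
    rw [hs, Complex.cpow_inv_two_im_eq_sqrt (by rw [ht₁im]; positivity)]
    positivity
  have hsnorm : ‖s‖ ≤ 1 := by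
    have h1 : ‖s‖ ^ 2 ≤ 1 := by
      rw [← norm_pow, hsq]
      refine (Complex.norm_le_abs_re_add_abs_im t₁).trans ?_
      rw [ht₁re, ht₁im, abs_of_pos ht0, abs_of_pos (by positivity)]
      nlinarith
    nlinarith [norm_nonneg s]
  -- the two arguments of the primitive
  set v : ℂ := N * s - b / s with hv
  set w : ℂ := N * s + b / s with hw
  have hinv : (t₁ : ℂ)⁻¹ = (1 - 2 * Complex.I) / (5 * t₀) := by
    have h5 : (1 + 2 * Complex.I) * (1 - 2 * Complex.I) = 5 := by
      linear_combination (-4 : ℂ) * Complex.I_sq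
    have ht0c : (t₀ : ℂ) ≠ 0 := by exact_mod_cast ht0.ne'
    have e : t₁ = t₀ * (1 + 2 * Complex.I) := by rw [ht₁]; push_cast; ring
    rw [e]
    refine inv_eq_of_mul_eq_one_right ?_
    field_simp
    exact h5
  have hNtc : (N : ℂ) * t₀ = b := by exact_mod_cast hNt
  have ht0c : (t₀ : ℂ) ≠ 0 := by exact_mod_cast ht0.ne'
  have hbt : (b : ℂ) ^ 2 / t₁ = N * b * ((1 - 2 * Complex.I) / 5) := by
    rw [div_eq_mul_inv, hinv, ← hNtc]
    field_simp
  have hNt1 : (N : ℂ) ^ 2 * t₁ = N * b * (1 + 2 * Complex.I) := by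
    rw [ht₁, ← hNtc]
    push_cast
    ring
  have hv2 : v ^ 2 = (N * b : ℝ) * (-(4 / 5) + 8 / 5 * Complex.I) := by
    have : v ^ 2 = N ^ 2 * s ^ 2 - 2 * N * b + b ^ 2 / s ^ 2 := by rw [hv]; field_simp; ring
    rw [this, hsq, hbt, hNt1]
    push_cast
    ring
  have hw2 : w ^ 2 = (N * b : ℝ) * (16 / 5 + 8 / 5 * Complex.I) := by
    have : w ^ 2 = N ^ 2 * s ^ 2 + 2 * N * b + b ^ 2 / s ^ 2 := by rw [hw]; field_simp; ring
    rw [this, hsq, hbt, hNt1]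
    push_cast
    ring
  set K : ℝ := N * b with hK
  have hK0 : 0 < K := by positivity
  have hvre : v.re ^ 2 - v.im ^ 2 = -(4 / 5 * K) := by
    have := congrArg Complex.re hv2
    simp [pow_two] at this
    linarith
  have hvim : v.re * v.im = 4 / 5 * K := by
    have := congrArg Complex.im hv2
    simp [pow_two] at this
    linarith
  have hwre : w.re ^ 2 - w.im ^ 2 = 16 / 5 * K := by
    have := congrArg Complex.re hw2
    simp [pow_two] at this
    linarith
  have hwim : w.re * w.im = 4 / 5 * K := by
    have := congrArg Complex.im hw2
    simp [pow_two] at this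
    linarith
  have hvpos : 0 ≤ v.im := by
    have : v.im = N * s.im + b * (s.im / Complex.normSq s) := by
      rw [hv, div_eq_mul_inv]
      simp [Complex.inv_im]
      ring
    rw [this]
    have := Complex.normSq_nonneg s
    positivity
  have hvx : |v.re| ≤ N := by
    have h1 : v.re ^ 2 * v.im ^ 2 = 16 / 25 * K ^ 2 := by rw [← mul_pow, hvim]; ring
    have h2 : v.re ^ 2 ≤ 1 / 2 * K := by
      by_contra! h
      nlinarith [sq_nonneg v.re]
    refine abs_le_of_sq_le_sq (h2.trans ?_) hN0.le
    rw [hK]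
    nlinarith
  have hwI : w.im ^ 2 ≤ 1 / 5 * K := by
    have h1 : w.re ^ 2 * w.im ^ 2 = 16 / 25 * K ^ 2 := by rw [← mul_pow, hwim]; ring
    by_contra! h
    nlinarith [sq_nonneg w.im]
  have hwR : w.re ^ 2 ≤ 17 / 5 * K := by linarith
  have hwy : |w.im| ≤ N := by
    refine abs_le_of_sq_le_sq (hwI.trans ?_) hN0.le
    rw [hK]
    nlinarith
  have hFv := norm_primitive_conj_sub_sub_le hF (x := v.re) hvpos
  have hFw := norm_primitive_conj_sub_le hF w.re w.im
  rw [hvre] at hFv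
  have hcv : (⟨v.re, -v.im⟩ : ℂ) = (starRingEnd ℂ) v := rfl
  have hcw : (⟨w.re, -w.im⟩ : ℂ) = (starRingEnd ℂ) w := rfl
  rw [hcv] at hFv
  rw [hcw] at hFw
  change ‖F v - F ((starRingEnd ℂ) v) - Complex.I * (√π : ℝ)‖ ≤ _ at hFv
  change ‖F w - F ((starRingEnd ℂ) w)‖ ≤ _ at hFw
  have hE : ∀ t : ℂ, (t = t₁ ∨ t = (starRingEnd ℂ) t₁) →
      ‖Complex.exp (b ^ 2 / t + N ^ 2 * t)‖ = Real.exp (6 / 5 * K) := by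
    have h1 : (b ^ 2 / t₁ + N ^ 2 * t₁).re = 6 / 5 * K := by
      rw [hbt, hNt1]
      simp [hK]
      ring
    rintro t (rfl | rfl)
    · rw [Complex.norm_exp, h1]
    · have : (b : ℂ) ^ 2 / (starRingEnd ℂ) t₁ + N ^ 2 * (starRingEnd ℂ) t₁ =
          (starRingEnd ℂ) (b ^ 2 / t₁ + N ^ 2 * t₁) := by simp
      rw [Complex.norm_exp, this, Complex.conj_re, h1]
  have hG1 : saddlePrimitive F N b t₁ = ((N : ℂ) ^ 2)⁻¹ * (s * Complex.exp (b ^ 2 / t₁ + N ^ 2 * t₁)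
    + (b - 1 / (2 * N)) * Complex.exp (2 * N * b) * F v
    - (b + 1 / (2 * N)) * Complex.exp (-(2 * N * b)) * F w) := rfl
  have hG2 : saddlePrimitive F N b ((starRingEnd ℂ) t₁) = ((N : ℂ) ^ 2)⁻¹ *
    ((starRingEnd ℂ) s * Complex.exp (b ^ 2 / (starRingEnd ℂ) t₁ + N ^ 2 * (starRingEnd ℂ) t₁)
    + (b - 1 / (2 * N)) * Complex.exp (2 * N * b) * F ((starRingEnd ℂ) v)
    - (b + 1 / (2 * N)) * Complex.exp (-(2 * N * b)) * F ((starRingEnd ℂ) w)) := by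
    have e1 : (starRingEnd ℂ) v = N * (starRingEnd ℂ) s - b / (starRingEnd ℂ) s := by
      rw [hv]; simp
    have e2 : (starRingEnd ℂ) w = N * (starRingEnd ℂ) s + b / (starRingEnd ℂ) s := by
      rw [hw]; simp
    rw [e1, e2, ← hsconj]
    rfl
  have hbN : b * N * 2 = π * N := by rw [hb]; ring
  have hexp2 : Complex.exp (2 * N * b) = (Real.exp (2 * K) : ℝ) := by
    rw [hK]; push_cast; ring_nf
  have hexp3 : Complex.exp (-(2 * N * b)) = (Real.exp (-(2 * K)) : ℝ) := by
    rw [hK]; push_cast; ring_nf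
  have hexp4 : Real.exp (π * N) = Real.exp (2 * K) := by rw [hK, hb]; ring_nf
  have hexp5 : Real.exp (0.7 * π * N) = Real.exp (7 / 5 * K) := by rw [hK, hb]; ring_nf
  have hkey : -Complex.I * (saddlePrimitive F N b t₁ - saddlePrimitive F N b ((starRingEnd ℂ) t₁)) -
      (((N ^ 2)⁻¹ * ((b - 1 / (2 * N)) * Real.exp (π * N) * √π) : ℝ) : ℂ) =
      -Complex.I * ((N : ℂ) ^ 2)⁻¹ * (s * Complex.exp (b ^ 2 / t₁ + N ^ 2 * t₁) -
        (starRingEnd ℂ) s * Complex.exp (b ^ 2 / (starRingEnd ℂ) t₁ + N ^ 2 * (starRingEnd ℂ) t₁) +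
        ((b - 1 / (2 * N)) * Real.exp (2 * K) : ℝ) *
          (F v - F ((starRingEnd ℂ) v) - Complex.I * (√π : ℝ)) -
        ((b + 1 / (2 * N)) * Real.exp (-(2 * K)) : ℝ) * (F w - F ((starRingEnd ℂ) w))) := by
    rw [hG1, hG2, hexp4, hexp2, hexp3]
    push_cast
    linear_combination (-((N : ℂ) ^ 2)⁻¹ * ((b - 1 / (2 * N)) * Complex.exp (2 * K)) * (√π : ℝ)) *
      Complex.I_sq
  rw [hkey, hexp5, norm_mul, norm_mul, norm_neg, Complex.norm_I, one_mul, norm_inv, norm_pow,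
    Complex.norm_real, Real.norm_of_nonneg hN0.le]
  have hsπ : √π ≤ 2 := Real.sqrt_le_iff.2 ⟨by norm_num, by linarith⟩
  have hN2 : 1 / (2 * N) ≤ 1 := by rw [div_le_one (by positivity)]; linarith
  have hN2' : 0 < 1 / (2 * N) := by positivity
  have b1 : ‖s * Complex.exp (b ^ 2 / t₁ + N ^ 2 * t₁)‖ ≤ Real.exp (7 / 5 * K) := by
    rw [norm_mul, hE _ (Or.inl rfl)]
    refine (mul_le_of_le_one_left (Real.exp_pos _).le hsnorm).trans (Real.exp_le_exp.2 (by linarith))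
  have b2 : ‖(starRingEnd ℂ) s * Complex.exp (b ^ 2 / (starRingEnd ℂ) t₁ +
      N ^ 2 * (starRingEnd ℂ) t₁)‖ ≤ Real.exp (7 / 5 * K) := by
    rw [norm_mul, hE _ (Or.inr rfl), Complex.norm_conj]
    refine (mul_le_of_le_one_left (Real.exp_pos _).le hsnorm).trans (Real.exp_le_exp.2 (by linarith))
  have b3 : ‖(((b - 1 / (2 * N)) * Real.exp (2 * K) : ℝ) : ℂ) *
      (F v - F ((starRingEnd ℂ) v) - Complex.I * (√π : ℝ))‖ ≤
      Real.exp (7 / 5 * K) * (2 * (2 * N + 2)) := by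
    rw [norm_mul, Complex.norm_real, Real.norm_of_nonneg
      (mul_nonneg (by linarith) (Real.exp_pos _).le)]
    calc (b - 1 / (2 * N)) * Real.exp (2 * K) * _
        ≤ 2 * Real.exp (2 * K) * (Real.exp (-(4 / 5 * K)) * (2 * N + 2)) := by
          gcongr
          · linarith
          · exact hFv.trans (by gcongr)
      _ = Real.exp (2 * K + -(4 / 5 * K)) * (2 * (2 * N + 2)) := by rw [Real.exp_add]; ring
      _ ≤ _ := by gcongr; linarith
  have b4 : ‖(((b + 1 / (2 * N)) * Real.exp (-(2 * K)) : ℝ) : ℂ) *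
      (F w - F ((starRingEnd ℂ) w))‖ ≤ Real.exp (7 / 5 * K) * (3 * (2 * N)) := by
    rw [norm_mul, Complex.norm_real, Real.norm_of_nonneg
      (mul_nonneg (by linarith) (Real.exp_pos _).le)]
    calc (b + 1 / (2 * N)) * Real.exp (-(2 * K)) * _
        ≤ 3 * Real.exp (-(2 * K)) * (Real.exp (17 / 5 * K) * (2 * N)) := by
          gcongr
          · linarith
          · exact hFw.trans (by gcongr)
      _ = Real.exp (-(2 * K) + 17 / 5 * K) * (3 * (2 * N)) := by rw [Real.exp_add]; ring
      _ = _ := by ring_nf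
  rw [inv_mul_le_iff₀ (by positivity)]
  refine (norm_sub_le _ _).trans ((add_le_add ((norm_add_le _ _).trans
    (add_le_add (norm_sub_le _ _) le_rfl)) le_rfl).trans ?_)
  refine (add_le_add (add_le_add (add_le_add b1 b2) b3) b4).trans ?_
  have : 6 + 10 * N ≤ N ^ 2 := by nlinarith
  nlinarith [Real.exp_pos (7 / 5 * K)]

end MainIntegralBound

section CircleMethod
open Set Filter Topology MeasureTheory

lemma norm_exp_neg_add {t₀ : ℝ} (y : ℝ) :
    ‖Complex.exp (-((t₀ : ℂ) + y * Complex.I))‖ = Real.exp (-t₀) := by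
  rw [Complex.norm_exp]; simp

lemma continuous_gen_exp {t₀ : ℝ} (ht : 0 < t₀) :
    Continuous fun y : ℝ => gen (Complex.exp (-((t₀ : ℂ) + y * Complex.I))) := by
  refine continuous_tsum (u := fun m => (pbar m : ℝ) * Real.exp (-t₀) ^ m) (fun m => by fun_prop)
    (summable_pbar_mul_pow (Real.exp_pos _).le (Real.exp_lt_one_iff.2 (by linarith))) fun m y => ?_
  rw [norm_mul, norm_pow, norm_exp_neg_add, Complex.norm_natCast]

lemma integral_exp_int_mul (k : ℤ) :
    ∫ y in (-π)..π, Complex.exp ((k * Complex.I) * (y : ℝ)) = if k = 0 then 2 * (π : ℂ) else 0 := by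
  split_ifs with h
  · subst h
    simp
    ring
  · have hk : (k : ℂ) * Complex.I ≠ 0 := mul_ne_zero (by exact_mod_cast h) Complex.I_ne_zero
    rw [integral_exp_mul_complex hk]
    have : Complex.exp (k * Complex.I * (π : ℝ)) = Complex.exp (k * Complex.I * (-π : ℝ)) := by
      rw [Complex.exp_eq_exp_iff_exists_int]
      exact ⟨k, by push_cast; ring⟩
    rw [this, sub_self, zero_div]

lemma cauchy_formula {t₀ : ℝ} (ht : 0 < t₀) (n : ℕ) :
    ∫ y in (-π)..π, gen (Complex.exp (-((t₀ : ℂ) + y * Complex.I))) *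
      Complex.exp (n * ((t₀ : ℂ) + y * Complex.I)) = 2 * π * pbar n := by
  have hs := summable_pbar_mul_pow (Real.exp_pos (-t₀)).le (Real.exp_lt_one_iff.2 (by linarith))
  have hnorm : ∀ (m : ℕ) (y : ℝ), ‖(pbar m : ℂ) * Complex.exp (-((t₀ : ℂ) + y * Complex.I)) ^ m *
      Complex.exp (n * ((t₀ : ℂ) + y * Complex.I))‖ =
      (pbar m : ℝ) * Real.exp (-t₀) ^ m * Real.exp (n * t₀) := fun m y => by
    rw [norm_mul, norm_mul, norm_pow, norm_exp_neg_add, Complex.norm_natCast, Complex.norm_exp]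
    simp
  have h := intervalIntegral.hasSum_integral_of_dominated_convergence
    (μ := volume) (a := -π) (b := π)
    (F := fun m (y : ℝ) => (pbar m : ℂ) * Complex.exp (-((t₀ : ℂ) + y * Complex.I)) ^ m *
      Complex.exp (n * ((t₀ : ℂ) + y * Complex.I)))
    (f := fun y : ℝ => gen (Complex.exp (-((t₀ : ℂ) + y * Complex.I))) *
      Complex.exp (n * ((t₀ : ℂ) + y * Complex.I)))
    (fun m _ => (pbar m : ℝ) * Real.exp (-t₀) ^ m * Real.exp (n * t₀))
    (fun m => Continuous.aestronglyMeasurable (by fun_prop))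
    (fun m => ae_of_all _ fun y _ => (hnorm m y).le)
    (ae_of_all _ fun y _ => hs.mul_right _) intervalIntegrable_const
    (ae_of_all _ fun y _ => by
      refine HasSum.mul_right _ (Summable.hasSum ?_)
      refine Summable.of_norm ?_
      refine hs.congr fun m => ?_
      rw [norm_mul, norm_pow, norm_exp_neg_add, Complex.norm_natCast])
  have hterm : ∀ m : ℕ, ∫ y in (-π)..π, (pbar m : ℂ) *
      Complex.exp (-((t₀ : ℂ) + y * Complex.I)) ^ m * Complex.exp (n * ((t₀ : ℂ) + y * Complex.I)) =
      if m = n then 2 * π * (pbar n : ℂ) else 0 := fun m => by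
    have e : ∀ y : ℝ, (pbar m : ℂ) *
      Complex.exp (-((t₀ : ℂ) + y * Complex.I)) ^ m * Complex.exp (n * ((t₀ : ℂ) + y * Complex.I)) =
      ((pbar m : ℂ) * Complex.exp ((n - m) * t₀)) *
        Complex.exp ((((n - m : ℤ) : ℂ) * Complex.I) * y) := fun y => by
      rw [← Complex.exp_nat_mul, mul_assoc, mul_assoc, ← Complex.exp_add, ← Complex.exp_add]
      push_cast
      ring_nf
    simp_rw [e]
    rw [intervalIntegral.integral_const_mul, integral_exp_int_mul]
    by_cases hmn : m = n
    · subst hmn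
      simp
      ring
    · rw [if_neg hmn, if_neg (by omega), mul_zero]
  simp_rw [hterm] at h
  exact (h.unique (hasSum_ite_eq n _))

/-- Away from the positive real axis the exponential factor in `norm_gen_le` is small. -/
lemma re_inv_one_sub_le {t₀ y : ℝ} (ht : 0 < t₀) (ht' : t₀ ≤ 0.0213) (hy : 2 * t₀ ≤ |y|)
    (hyπ : |y| ≤ π) :
    (1 - Complex.exp (-((t₀ : ℂ) + y * Complex.I)))⁻¹.re - (1 - Real.exp (-t₀))⁻¹ ≤
      -(0.59 / t₀) := by
  set r := Real.exp (-t₀) with hr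
  have hr1 : r < 1 := Real.exp_lt_one_iff.2 (by linarith)
  have hr0 : 1 - t₀ ≤ r := by have := Real.add_one_le_exp (-t₀); linarith
  have ha : 0 < 1 - r := by linarith
  have hq : Complex.exp (-((t₀ : ℂ) + y * Complex.I)) = ⟨r * Real.cos y, -(r * Real.sin y)⟩ := by
    apply Complex.ext
    · rw [Complex.exp_re]; simp [hr]
    · rw [Complex.exp_im]; simp [hr]
  have hcs := Real.sin_sq_add_cos_sq y
  set D := 1 - 2 * r * Real.cos y + r ^ 2 with hD
  have hcos := Real.cos_le_one_sub_mul_cos_sq hyπ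
  have hy2 : 4 * t₀ ^ 2 ≤ y ^ 2 := by
    rw [← sq_abs y]; nlinarith
  have hπ2 : π ^ 2 < 9.87 := by
    have := Real.pi_lt_d4
    nlinarith [Real.pi_pos]
  have hc2 : 8 / 9.87 * t₀ ^ 2 ≤ 1 - Real.cos y := by
    have h1 : 2 / 9.87 ≤ 2 / π ^ 2 := by gcongr
    have h2 : 2 / 9.87 * (4 * t₀ ^ 2) ≤ 2 / π ^ 2 * y ^ 2 := by gcongr
    linarith
  have hDa : 2.5 * (1 - r) ^ 2 ≤ D := by
    have h1 : 0.978 * (8 / 9.87 * t₀ ^ 2) ≤ r * (1 - Real.cos y) := by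
      have : (0.978 : ℝ) ≤ r := by norm_num at ht' ⊢; linarith
      gcongr
    have h2 : (1 - r) ^ 2 ≤ t₀ ^ 2 := by gcongr; linarith
    rw [hD]
    norm_num at h1 ⊢
    nlinarith [sq_nonneg t₀]
  have hD0 : 0 < D := lt_of_lt_of_le (by positivity) hDa
  have hre : (1 - Complex.exp (-((t₀ : ℂ) + y * Complex.I)))⁻¹.re = 1 / 2 + (1 - r ^ 2) / (2 * D) := by
    rw [hq, Complex.inv_re, Complex.normSq_apply]
    have e : (1 - (⟨r * Real.cos y, -(r * Real.sin y)⟩ : ℂ)).re *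
        (1 - (⟨r * Real.cos y, -(r * Real.sin y)⟩ : ℂ)).re +
        (1 - (⟨r * Real.cos y, -(r * Real.sin y)⟩ : ℂ)).im *
        (1 - (⟨r * Real.cos y, -(r * Real.sin y)⟩ : ℂ)).im = D := by
      simp only [Complex.sub_re, Complex.one_re, Complex.sub_im, Complex.one_im, hD]
      linear_combination r ^ 2 * hcs
    rw [e]
    simp only [Complex.sub_re, Complex.one_re]
    field_simp
    rw [hD]
    ring
  have hinv : (1 - r)⁻¹ = 1 / 2 + (1 + r) / (2 * (1 - r)) := by
    field_simp
    ring
  rw [hre, hinv]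
  have h3 : (1 - r ^ 2) / (2 * D) ≤ 0.4 * ((1 + r) / (2 * (1 - r))) := by
    rw [div_le_iff₀ (by positivity)]
    have : 0.4 * ((1 + r) / (2 * (1 - r))) * (2 * D) = (1 + r) * (0.4 * D) / (1 - r) := by
      field_simp
    rw [this, le_div_iff₀ ha]
    have h4 : (1 - r) ^ 2 ≤ 0.4 * D := by norm_num at hDa ⊢; linarith
    have h5 : 0 < 1 + r := by linarith [Real.exp_pos (-t₀)]
    nlinarith
  have h6 : 0.59 / t₀ ≤ 0.6 * ((1 + r) / (2 * (1 - r))) := by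
    rw [div_le_iff₀ ht]
    have : 0.6 * ((1 + r) / (2 * (1 - r))) * t₀ = 0.3 * (1 + r) * t₀ / (1 - r) := by
      field_simp
      ring
    rw [this, le_div_iff₀ ha]
    norm_num at ht' ⊢
    nlinarith
  linarith

lemma pi_div_sqrt_facts {N : ℝ} (hN : 74 ≤ N) :
    0 < π / 2 / N ∧ π / 2 / N ≤ 0.0213 ∧ π ^ 2 / 4 * (π / 2 / N)⁻¹ = π * N / 2 ∧
      Real.exp (-(2 * π ^ 2 * ((π / 2 / N)⁻¹ / 5))) ≤ Real.exp (-(0.3 * π * N)) ∧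
      Real.exp (-(0.3 * π * N)) ≤ 1 / 4 := by
  have hπ3 := Real.pi_gt_three
  have hπ4 := Real.pi_lt_d2
  have hN0 : 0 < N := by linarith
  refine ⟨by positivity, ?_, ?_, Real.exp_le_exp.2 ?_, ?_⟩
  · rw [div_le_iff₀ hN0]; norm_num at *; linarith
  · field_simp; norm_num
  · have : 2 * π ^ 2 * ((π / 2 / N)⁻¹ / 5) = 0.8 * π * N := by field_simp; norm_num
    rw [this]
    have := mul_pos Real.pi_pos hN0
    norm_num
    nlinarith
  · rw [Real.exp_neg, inv_le_comm₀ (Real.exp_pos _) (by norm_num)]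
    have := Real.add_one_le_exp (0.3 * π * N)
    norm_num at *
    nlinarith

lemma norm_half_cpow_le {z : ℂ} (hz : ‖z‖ ≤ 1) : ‖z ^ (1 / 2 : ℂ)‖ ≤ 1 := by
  have : ‖z ^ (1 / 2 : ℂ)‖ ^ 2 = ‖z‖ := by
    rw [← norm_pow]
    congr 1
    simp
  nlinarith [norm_nonneg (z ^ (1 / 2 : ℂ))]

lemma norm_gen_minor_le {N : ℝ} (hN : 74 ≤ N) {y : ℝ} (hy : 2 * (π / 2 / N) ≤ |y|)
    (hyπ : |y| ≤ π) :
    ‖gen (Complex.exp (-(((π / 2 / N : ℝ) : ℂ) + y * Complex.I)))‖ ≤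
      Real.exp (π * N / 2 - 0.75 * N) := by
  obtain ⟨h0, h1, h2, h3, h4⟩ := pi_div_sqrt_facts hN
  set t₀ := π / 2 / N with ht₀
  have hπ3 := Real.pi_gt_three
  have hπ4 := Real.pi_lt_d4
  have hN0 : 0 < N := by linarith
  have hlt : ‖Complex.exp (-((t₀ : ℂ) + y * Complex.I))‖ < 1 := by
    rw [norm_exp_neg_add]; exact Real.exp_lt_one_iff.2 (by linarith)
  have hm := norm_gen_le hlt
  rw [norm_exp_neg_add] at hm
  have hre := re_inv_one_sub_le h0 h1 hy hyπ
  have hsave : 2 * (0.59 / t₀) ≥ 0.75 * N := by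
    rw [ht₀]
    have : 2 * (0.59 / (π / 2 / N)) = 2.36 * N / π := by field_simp; norm_num
    rw [this, ge_iff_le, le_div_iff₀ Real.pi_pos]
    norm_num at *
    nlinarith
  have hρ : Real.exp (-(2 * π ^ 2 * ((t₀ : ℂ)⁻¹).re)) ≤ 1 / 4 := by
    rw [← Complex.ofReal_inv, Complex.ofReal_re]
    refine le_trans (Real.exp_le_exp.2 ?_) (h3.trans h4)
    have : 0 < t₀⁻¹ := by positivity
    nlinarith [sq_nonneg π]
  have hg := gen_approx (t := (t₀ : ℂ)) (by simpa using h0) hρ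
  have hre' : ((t₀ : ℂ)⁻¹).re = t₀⁻¹ := by rw [← Complex.ofReal_inv, Complex.ofReal_re]
  rw [hre', h2] at hg
  have hpow : ‖((t₀ : ℂ) / π) ^ (1 / 2 : ℂ)‖ ≤ 1 := by
    refine norm_half_cpow_le ?_
    rw [← Complex.ofReal_div, Complex.norm_real, Real.norm_of_nonneg (by positivity),
      div_le_one Real.pi_pos]
    norm_num at *
    linarith
  have hmodel : ‖(1 / 2 : ℂ) * ((t₀ : ℂ) / π) ^ (1 / 2 : ℂ) * Complex.exp (π ^ 2 / 4 * (t₀ : ℂ)⁻¹)‖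
      ≤ 1 / 2 * Real.exp (π * N / 2) := by
    rw [norm_mul, norm_mul, Complex.norm_exp]
    have : ((π : ℂ) ^ 2 / 4 * (t₀ : ℂ)⁻¹).re = π * N / 2 := by
      rw [← h2]
      norm_cast
    rw [this]
    have h12 : ‖(1 / 2 : ℂ)‖ = 1 / 2 := by norm_num
    rw [h12]
    gcongr
    linarith
  have hgen : ‖gen ((Real.exp (-t₀) : ℝ) : ℂ)‖ ≤ Real.exp (π * N / 2) := by
    rw [Complex.ofReal_exp, Complex.ofReal_neg]
    have h5 := norm_le_norm_add_norm_sub' (gen (Complex.exp (-(t₀ : ℂ))))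
      ((1 / 2 : ℂ) * ((t₀ : ℂ) / π) ^ (1 / 2 : ℂ) * Complex.exp (π ^ 2 / 4 * (t₀ : ℂ)⁻¹))
    have h6 : ‖((t₀ : ℂ) / π) ^ (1 / 2 : ℂ)‖ * Real.exp (π * N / 2) *
        Real.exp (-(2 * π ^ 2 * t₀⁻¹)) ≤ 1 * Real.exp (π * N / 2) * (1 / 4) := by
      rw [hre'] at hρ
      gcongr
    linarith [Real.exp_pos (π * N / 2)]
  refine hm.trans ?_
  calc _ ≤ Real.exp (π * N / 2) * Real.exp (-(0.75 * N)) := by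
        gcongr
        linarith
    _ = _ := by rw [← Real.exp_add]; ring_nf

end CircleMethod

section Asymptotic
open Set Filter Topology MeasureTheory

lemma div_pi_cpow_half {t : ℂ} (ht : t ≠ 0) :
    (t / π) ^ (1 / 2 : ℂ) = ((√π)⁻¹ : ℝ) * t ^ (2⁻¹ : ℂ) := by
  have hπ : (0 : ℝ) < π⁻¹ := inv_pos.2 Real.pi_pos
  have e : t / π = ((π⁻¹ : ℝ) : ℂ) * t := by push_cast; rw [div_eq_inv_mul]
  have hπ0 : ((π⁻¹ : ℝ) : ℂ) ≠ 0 := by exact_mod_cast hπ.ne'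
  rw [e, Complex.cpow_def_of_ne_zero (mul_ne_zero hπ0 ht), Complex.log_ofReal_mul hπ ht, add_mul,
    Complex.exp_add, Complex.cpow_def_of_ne_zero ht, one_div]
  congr 1
  rw [← Real.sqrt_inv, Real.sqrt_eq_rpow, Real.rpow_def_of_pos hπ]
  push_cast
  ring_nf

lemma norm_gen_sub_model_le {N : ℝ} (hN : 74 ≤ N) {y : ℝ} (hy : |y| ≤ 2 * (π / 2 / N)) :
    ‖gen (Complex.exp (-(((π / 2 / N : ℝ) : ℂ) + y * Complex.I))) -
      1 / 2 * ((((π / 2 / N : ℝ) : ℂ) + y * Complex.I) / π) ^ (1 / 2 : ℂ) *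
        Complex.exp (π ^ 2 / 4 * (((π / 2 / N : ℝ) : ℂ) + y * Complex.I)⁻¹)‖ ≤
      Real.exp (π * N / 2 - 0.75 * N) := by
  obtain ⟨h0, h1, h2, h3, h4⟩ := pi_div_sqrt_facts hN
  set t₀ := π / 2 / N with ht₀
  have hπ3 := Real.pi_gt_three
  have hN0 : 0 < N := by linarith
  set t : ℂ := (t₀ : ℂ) + y * Complex.I with ht
  have hre : t.re = t₀ := by simp [ht]
  have him : t.im = y := by simp [ht]
  have hy2 : y ^ 2 ≤ 4 * t₀ ^ 2 := by rw [← sq_abs y]; nlinarith [abs_nonneg y]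
  have hinv : t⁻¹.re = t₀ / (t₀ ^ 2 + y ^ 2) := by
    rw [Complex.inv_re, Complex.normSq_apply, hre, him, pow_two, pow_two]
  have hlow : t₀⁻¹ / 5 ≤ t⁻¹.re := by
    rw [hinv, le_div_iff₀ (by positivity)]
    field_simp
    linarith
  have hup : t⁻¹.re ≤ t₀⁻¹ := by
    rw [hinv, div_le_iff₀ (by positivity)]
    field_simp
    nlinarith [sq_nonneg y]
  have hρ1 : Real.exp (-(2 * π ^ 2 * t⁻¹.re)) ≤ Real.exp (-(0.3 * π * N)) := by
    refine le_trans (Real.exp_le_exp.2 ?_) h3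
    nlinarith [sq_nonneg π]
  refine (gen_approx (by rw [hre]; exact h0) (hρ1.trans h4)).trans ?_
  have hpow : ‖(t / π) ^ (1 / 2 : ℂ)‖ ≤ 1 := by
    refine norm_half_cpow_le ?_
    rw [norm_div, Complex.norm_real, Real.norm_of_nonneg Real.pi_pos.le, div_le_one Real.pi_pos]
    refine (Complex.norm_le_abs_re_add_abs_im t).trans ?_
    rw [hre, him, abs_of_pos h0]
    norm_num at *
    linarith
  calc _ ≤ 1 * Real.exp (π * N / 2) * Real.exp (-(0.3 * π * N)) := by
        gcongr
        rw [← h2]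
        gcongr
    _ = Real.exp (π * N / 2 - 0.3 * π * N) := by rw [one_mul, ← Real.exp_add]; ring_nf
    _ ≤ _ := Real.exp_le_exp.2 (by norm_num; nlinarith)

theorem abs_pbar_sub_le {n : ℕ} (hn : 5505 ≤ n) :
    |(pbar n : ℝ) - Real.exp (π * √n) / (8 * n) * (1 - 1 / (π * √n))| ≤
      2 * Real.exp (π * √n - 0.75 * √n) := by
  set N : ℝ := √n with hNdef
  have hn' : (5505 : ℝ) ≤ n := by exact_mod_cast hn
  have hN : 74 ≤ N := Real.le_sqrt_of_sq_le (by norm_num; linarith)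
  have hN2 : N ^ 2 = n := Real.sq_sqrt (by linarith)
  obtain ⟨h0, h1, h2, h3, h4⟩ := pi_div_sqrt_facts hN
  have hmain := norm_main_integral_sub_le hN
  have hmajor := fun y => @norm_gen_sub_model_le N hN y
  have hminor := fun y => @norm_gen_minor_le N hN y
  have hπ3 := Real.pi_gt_three
  have hN0 : 0 < N := by linarith
  have hY : 2 * (π / 2 / N) ≤ 1 / 2 := by norm_num at h1 ⊢; linarith
  have hnt : (n : ℝ) * (π / 2 / N) = π * N / 2 := by rw [← hN2]; field_simp
  set t₀ := π / 2 / N with ht₀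
  have hcauchy := cauchy_formula h0 n
  have hcf := (continuous_gen_exp h0).mul
    (show Continuous fun y : ℝ => Complex.exp (n * ((t₀ : ℂ) + y * Complex.I)) by fun_prop)
  have hcg := continuous_model h0 N (π / 2)
  set f : ℝ → ℂ := fun y => gen (Complex.exp (-((t₀ : ℂ) + y * Complex.I))) *
      Complex.exp (n * ((t₀ : ℂ) + y * Complex.I)) with hf
  set g : ℝ → ℂ := fun y => ((t₀ : ℂ) + y * Complex.I) ^ (2⁻¹ : ℂ) *
      Complex.exp (((π / 2 : ℝ) : ℂ) ^ 2 / (t₀ + y * Complex.I) + (N : ℂ) ^ 2 * (t₀ + y * Complex.I))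
    with hg
  change Continuous f at hcf
  set S := Real.exp (π * N - 0.75 * N) with hS
  have hexpn : ∀ y : ℝ, ‖Complex.exp (n * ((t₀ : ℂ) + y * Complex.I))‖ = Real.exp (π * N / 2) :=
    fun y => by rw [Complex.norm_exp, ← hnt]; simp
  have hSe : Real.exp (π * N / 2 - 0.75 * N) * Real.exp (π * N / 2) = S := by
    rw [hS, ← Real.exp_add]; ring_nf
  have hfS : ∀ y : ℝ, 2 * t₀ ≤ |y| → |y| ≤ π → ‖f y‖ ≤ S := fun y hy hy' => by
    rw [hf, ← hSe, norm_mul, hexpn]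
    exact mul_le_mul_of_nonneg_right (hminor y hy hy') (Real.exp_pos _).le
  have hfg : ∀ y : ℝ, |y| ≤ 2 * t₀ → ‖f y - ((2 * √π)⁻¹ : ℝ) * g y‖ ≤ S := fun y hy => by
    have ht0 : (t₀ : ℂ) + y * Complex.I ≠ 0 := fun h => by
      have := congrArg Complex.re h
      simp at this
      exact h0.ne' this
    have e : f y - ((2 * √π)⁻¹ : ℝ) * g y = (gen (Complex.exp (-((t₀ : ℂ) + y * Complex.I))) -
      1 / 2 * (((t₀ : ℂ) + y * Complex.I) / π) ^ (1 / 2 : ℂ) *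
        Complex.exp (π ^ 2 / 4 * ((t₀ : ℂ) + y * Complex.I)⁻¹)) *
      Complex.exp (n * ((t₀ : ℂ) + y * Complex.I)) := by
      simp only [hf, hg]
      rw [div_pi_cpow_half ht0, sub_mul, mul_assoc _ (Complex.exp _) (Complex.exp _),
        ← Complex.exp_add]
      have e1 : ((π / 2 : ℝ) : ℂ) ^ 2 / (t₀ + y * Complex.I) + (N : ℂ) ^ 2 * (t₀ + y * Complex.I) =
          π ^ 2 / 4 * ((t₀ : ℂ) + y * Complex.I)⁻¹ + n * ((t₀ : ℂ) + y * Complex.I) := by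
        rw [show (N : ℂ) ^ 2 = n by exact_mod_cast hN2]
        push_cast
        ring
      rw [e1]
      push_cast
      ring
    rw [e, norm_mul, hexpn, ← hSe]
    exact mul_le_mul_of_nonneg_right (hmajor y hy) (Real.exp_pos _).le
  -- splitting the integral
  have hfint : ∀ a b, IntervalIntegrable f volume a b := fun a b => hcf.intervalIntegrable a b
  have hsplit : ∫ y in (-π)..π, f y = (∫ y in (-π)..(-(2 * t₀)), f y) +
      (∫ y in (-(2 * t₀))..(2 * t₀), f y) + ∫ y in (2 * t₀)..π, f y := by
    rw [intervalIntegral.integral_add_adjacent_intervals (hfint _ _) (hfint _ _),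
      intervalIntegral.integral_add_adjacent_intervals (hfint _ _) (hfint _ _)]
  have hSpos : 0 < S := Real.exp_pos _
  have hL : ‖∫ y in (-π)..(-(2 * t₀)), f y‖ ≤ S * π := by
    refine (intervalIntegral.norm_integral_le_of_norm_le_const (C := S) fun y hy => ?_).trans ?_
    · rw [uIoc_of_le (by linarith)] at hy
      have : |y| = -y := abs_of_neg (by linarith [hy.2])
      exact hfS y (by rw [this]; linarith [hy.2]) (by rw [this]; linarith [hy.1])
    · gcongr
      rw [abs_of_nonneg (by linarith)]
      linarith
  have hR : ‖∫ y in (2 * t₀)..π, f y‖ ≤ S * π := by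
    refine (intervalIntegral.norm_integral_le_of_norm_le_const (C := S) fun y hy => ?_).trans ?_
    · rw [uIoc_of_le (by linarith)] at hy
      have : |y| = y := abs_of_pos (by linarith [hy.1])
      exact hfS y (by rw [this]; linarith [hy.1]) (by rw [this]; linarith [hy.2])
    · gcongr
      rw [abs_of_nonneg (by linarith)]
      linarith
  have hM : ‖(∫ y in (-(2 * t₀))..(2 * t₀), f y) -
      ((2 * √π)⁻¹ : ℝ) * ∫ y in (-(2 * t₀))..(2 * t₀), g y‖ ≤ S * 1 := by
    rw [← intervalIntegral.integral_const_mul, ← intervalIntegral.integral_sub (hfint _ _)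
      ((hcg.intervalIntegrable _ _).const_mul _)]
    refine (intervalIntegral.norm_integral_le_of_norm_le_const (C := S) fun y hy => ?_).trans ?_
    · rw [uIoc_of_le (by linarith)] at hy
      exact hfg y (abs_le.2 ⟨hy.1.le, hy.2⟩)
    · gcongr
      rw [abs_of_nonneg (by linarith)]
      linarith
  have hJ : ‖(((2 * √π)⁻¹ : ℝ) : ℂ) * ((∫ y in (-(2 * t₀))..(2 * t₀), g y) -
      ((N ^ 2)⁻¹ * ((π / 2 - 1 / (2 * N)) * Real.exp (π * N) * √π) : ℝ))‖ ≤ S := by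
    rw [norm_mul, Complex.norm_real, Real.norm_of_nonneg (by positivity)]
    have hs1 : 1 ≤ √π := Real.one_le_sqrt.2 (by linarith)
    calc _ ≤ 1 * Real.exp (0.7 * π * N) := by
          gcongr
          exact inv_le_one_of_one_le₀ (by linarith)
      _ ≤ S := by
          rw [one_mul]
          refine Real.exp_le_exp.2 ?_
          norm_num
          nlinarith
  have hsp : √π ≠ 0 := by positivity
  have hkey : ((2 * π * ((pbar n : ℝ) - Real.exp (π * N) / (8 * n) * (1 - 1 / (π * N))) : ℝ) : ℂ) =
      (∫ y in (-π)..(-(2 * t₀)), f y) + (∫ y in (2 * t₀)..π, f y) +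
      ((∫ y in (-(2 * t₀))..(2 * t₀), f y) -
        ((2 * √π)⁻¹ : ℝ) * ∫ y in (-(2 * t₀))..(2 * t₀), g y) +
      (((2 * √π)⁻¹ : ℝ) : ℂ) * ((∫ y in (-(2 * t₀))..(2 * t₀), g y) -
      ((N ^ 2)⁻¹ * ((π / 2 - 1 / (2 * N)) * Real.exp (π * N) * √π) : ℝ)) := by
    have e2 : 2 * π * (Real.exp (π * N) / (8 * n) * (1 - 1 / (π * N))) =
        (2 * √π)⁻¹ * ((N ^ 2)⁻¹ * ((π / 2 - 1 / (2 * N)) * Real.exp (π * N) * √π)) := by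
      rw [← hN2]
      field_simp
      ring
    rw [mul_sub, e2, Complex.ofReal_sub, Complex.ofReal_mul (2 * √π)⁻¹]
    have e3 : ((2 * π * (pbar n : ℝ) : ℝ) : ℂ) = ∫ y in (-π)..π, f y := by
      rw [hcauchy]; push_cast; ring
    rw [e3, hsplit]
    ring
  have hbound := congrArg norm hkey
  rw [Complex.norm_real, Real.norm_eq_abs, abs_mul, abs_of_pos (by positivity)] at hbound
  have h5 := (hbound.le.trans (norm_add_le _ _)).trans (add_le_add ((norm_add_le _ _).trans
    (add_le_add ((norm_add_le _ _).trans (add_le_add hL hR)) hM)) hJ)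
  have h6 : 2 * π * |(pbar n : ℝ) - Real.exp (π * N) / (8 * n) * (1 - 1 / (π * N))| ≤
      2 * π * (2 * S) := h5.trans (by nlinarith)
  exact le_of_mul_le_mul_left h6 (by positivity)

end Asymptotic

section LogAsymptotic
open Finset

lemma mul_pow_le_exp {N : ℝ} (hN : 74 ≤ N) : 34 * N ^ 8 ≤ Real.exp (0.75 * N) := by
  have h1 : N ≤ Real.exp (4 + N / 74) := by
    have h2 := Real.add_one_le_exp (N / 74 - 1)
    have h3 : (74 : ℝ) ≤ Real.exp 5 := by
      have : Real.exp 5 = Real.exp 1 ^ 5 := by rw [← Real.exp_nat_mul]; norm_num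
      rw [this]
      calc (74 : ℝ) ≤ 2.5 ^ 5 := by norm_num
        _ ≤ _ := by gcongr; linarith [Real.exp_one_gt_d9]
    calc N = 74 * (N / 74) := by ring
      _ ≤ Real.exp 5 * Real.exp (N / 74 - 1) := by gcongr; linarith
      _ = _ := by rw [← Real.exp_add]; ring_nf
  have h4 : (34 : ℝ) ≤ Real.exp 4 := by
    have : Real.exp 4 = Real.exp 1 ^ 4 := by rw [← Real.exp_nat_mul]; norm_num
    rw [this]
    calc (34 : ℝ) ≤ 2.5 ^ 4 := by norm_num
      _ ≤ _ := by gcongr; linarith [Real.exp_one_gt_d9]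
  calc 34 * N ^ 8 ≤ Real.exp 4 * Real.exp (4 + N / 74) ^ 8 := by gcongr
    _ = Real.exp (36 + 8 * (N / 74)) := by
        rw [← Real.exp_nat_mul, ← Real.exp_add]; push_cast; ring_nf
    _ ≤ _ := Real.exp_le_exp.2 (by norm_num; linarith)

lemma abs_log_one_add_le {δ : ℝ} (h : |δ| ≤ 1 / 2) : |Real.log (1 + δ)| ≤ 2 * |δ| := by
  obtain ⟨h1, h2⟩ := abs_le.1 h
  have hpos : 0 < 1 + δ := by linarith
  have hup := Real.log_le_sub_one_of_pos hpos
  have hlow := Real.one_sub_inv_le_log_of_pos hpos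
  have e : 1 - (1 + δ)⁻¹ = δ / (1 + δ) := by field_simp; ring
  rw [e] at hlow
  have h3 : -(2 * |δ|) ≤ δ / (1 + δ) := by
    rw [le_div_iff₀ hpos]
    nlinarith [neg_abs_le δ, abs_nonneg δ]
  rw [abs_le]
  constructor <;> linarith [le_abs_self δ, abs_nonneg δ]

/-- Logarithmic form of the asymptotic expansion of `pbar`. -/
lemma pbar_pos_and_log_expansion {n : ℕ} (hn : 5505 ≤ n) :
    0 < (pbar n : ℝ) ∧
    |Real.log (pbar n) - (π * √n - Real.log 8 - Real.log n -
      ∑ k ∈ range 5, (1 / (π * √n)) ^ (k + 1) / (k + 1))| ≤ 5 / 4 * (1 / (n : ℝ) ^ 3) := by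
  have h := abs_pbar_sub_le hn
  have hn' : (5505 : ℝ) ≤ n := by exact_mod_cast hn
  have hn0 : (0 : ℝ) < n := by linarith
  set N : ℝ := √n with hNdef
  have hN : 74 ≤ N := Real.le_sqrt_of_sq_le (by norm_num; linarith)
  have hN2 : N ^ 2 = n := Real.sq_sqrt (by linarith)
  have hπ3 := Real.pi_gt_three
  have hN0 : 0 < N := by linarith
  set u := 1 / (π * N) with hu
  have hu0 : 0 < u := by positivity
  have hu1 : u ≤ 1 / 222 := by rw [hu]; exact one_div_le_one_div_of_le (by norm_num) (by nlinarith)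
  have huN : u ≤ 1 / (3 * N) := by rw [hu]; gcongr
  set M := Real.exp (π * N) / (8 * n) * (1 - u) with hM
  have hM0 : 0 < M := by
    have : 0 < 1 - u := by linarith
    positivity
  set δ := ((pbar n : ℝ) - M) / M with hδ
  have hδ1 : |δ| ≤ 1 / (2 * (n : ℝ) ^ 3) := by
    rw [hδ, abs_div, abs_of_pos hM0, div_le_iff₀ hM0]
    refine h.trans ?_
    have e : Real.exp (π * N - 0.75 * N) = Real.exp (π * N) / Real.exp (0.75 * N) := Real.exp_sub _ _
    have h2 := mul_pow_le_exp hN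
    have e8 : N ^ 8 = (n : ℝ) ^ 4 := by rw [← hN2]; ring
    rw [e8] at h2
    rw [e, hM]
    have h3 : Real.exp (π * N) / Real.exp (0.75 * N) ≤ Real.exp (π * N) / (34 * (n : ℝ) ^ 4) := by
      gcongr
    have h4 : 1 / (2 * (n : ℝ) ^ 3) * (Real.exp (π * N) / (8 * n) * (1 - u)) =
        (34 / 16 * (1 - u)) * (Real.exp (π * N) / (34 * (n : ℝ) ^ 4)) := by
      field_simp
      ring
    rw [h4]
    refine (mul_le_mul_of_nonneg_left h3 (by norm_num)).trans ?_
    refine mul_le_mul_of_nonneg_right ?_ (by positivity)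
    linarith
  have hn3 : (1 : ℝ) ≤ (n : ℝ) ^ 3 := one_le_pow₀ (by linarith)
  have hδ2 : |δ| ≤ 1 / 2 := hδ1.trans (one_div_le_one_div_of_le (by norm_num) (by linarith))
  have hpos : 0 < 1 + δ := by linarith [neg_abs_le δ]
  have hp : (pbar n : ℝ) = M * (1 + δ) := by rw [hδ]; field_simp; ring
  refine ⟨by rw [hp]; positivity, ?_⟩
  have h1u : (1 : ℝ) - u ≠ 0 := by linarith
  have hlog : Real.log (pbar n) =
      π * N - Real.log 8 - Real.log n + Real.log (1 - u) + Real.log (1 + δ) := by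
    rw [hp, Real.log_mul hM0.ne' hpos.ne', hM, Real.log_mul (by positivity) h1u,
      Real.log_div (by positivity) (by positivity), Real.log_exp,
      Real.log_mul (by norm_num) hn0.ne']
    ring
  have hser := Real.abs_log_sub_add_sum_range_le (x := u) (by rw [abs_of_pos hu0]; linarith) 5
  rw [abs_of_pos hu0] at hser
  have hser2 : u ^ (5 + 1) / (1 - u) ≤ 1 / 4 * (1 / (n : ℝ) ^ 3) := by
    rw [div_le_iff₀ (by linarith)]
    have h6 : u ^ 6 ≤ (1 / (3 * N)) ^ 6 := by gcongr
    have h7 : (1 / (3 * N)) ^ 6 = 1 / 729 * (1 / (n : ℝ) ^ 3) := by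
      rw [← hN2]; field_simp; norm_num
    have h8 : 0 < 1 / (n : ℝ) ^ 3 := by positivity
    rw [h7] at h6
    norm_num only
    nlinarith
  have hδ3 := abs_log_one_add_le hδ2
  have e9 : 1 / (2 * (n : ℝ) ^ 3) = 1 / 2 * (1 / (n : ℝ) ^ 3) := by field_simp
  rw [e9] at hδ1
  rw [hlog]
  have e10 : π * N - Real.log 8 - Real.log n + Real.log (1 - u) + Real.log (1 + δ) -
      (π * N - Real.log 8 - Real.log n - ∑ k ∈ range 5, u ^ (k + 1) / ((k : ℝ) + 1)) =
      (∑ k ∈ range 5, u ^ (k + 1) / ((k : ℝ) + 1) + Real.log (1 - u)) + Real.log (1 + δ) := by ring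
  rw [e10]
  refine (abs_add_le _ _).trans ?_
  linarith

end LogAsymptotic

section ThirdDifference

/-- `g₃` is the third derivative of `g` on the positive half-line. -/
def HasThirdDeriv (g g₃ : ℝ → ℝ) : Prop :=
  ∃ g₁ g₂ : ℝ → ℝ, ∀ x, 0 < x →
    HasDerivAt g (g₁ x) x ∧ HasDerivAt g₁ (g₂ x) x ∧ HasDerivAt g₂ (g₃ x) x

lemma HasThirdDeriv.add {f g f₃ g₃ : ℝ → ℝ} (hf : HasThirdDeriv f f₃) (hg : HasThirdDeriv g g₃) :
    HasThirdDeriv (fun x => f x + g x) fun x => f₃ x + g₃ x := by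
  obtain ⟨f₁, f₂, hf⟩ := hf
  obtain ⟨g₁, g₂, hg⟩ := hg
  exact ⟨fun x => f₁ x + g₁ x, fun x => f₂ x + g₂ x, fun x hx =>
    ⟨(hf x hx).1.add (hg x hx).1, (hf x hx).2.1.add (hg x hx).2.1,
      (hf x hx).2.2.add (hg x hx).2.2⟩⟩

lemma HasThirdDeriv.const_mul {f f₃ : ℝ → ℝ} (c : ℝ) (hf : HasThirdDeriv f f₃) :
    HasThirdDeriv (fun x => c * f x) fun x => c * f₃ x := by
  obtain ⟨f₁, f₂, hf⟩ := hf
  exact ⟨fun x => c * f₁ x, fun x => c * f₂ x, fun x hx =>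
    ⟨(hf x hx).1.const_mul c, (hf x hx).2.1.const_mul c, (hf x hx).2.2.const_mul c⟩⟩

lemma HasThirdDeriv.sum {ι : Type*} (s : Finset ι) {f f₃ : ι → ℝ → ℝ}
    (hf : ∀ i ∈ s, HasThirdDeriv (f i) (f₃ i)) :
    HasThirdDeriv (fun x => ∑ i ∈ s, f i x) fun x => ∑ i ∈ s, f₃ i x := by
  classical
  induction s using Finset.induction_on with
  | empty =>
    exact ⟨fun _ => 0, fun _ => 0, fun x _ => by
      simp only [Finset.sum_empty]
      exact ⟨hasDerivAt_const x 0, hasDerivAt_const x 0, hasDerivAt_const x 0⟩⟩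
  | insert a s ha ih =>
    simp only [Finset.sum_insert ha]
    exact (hf a (Finset.mem_insert_self a s)).add
      (ih fun i hi => hf i (Finset.mem_insert_of_mem hi))

lemma hasThirdDeriv_rpow_neg (s : ℝ) :
    HasThirdDeriv (fun x => x ^ (-s)) fun x => -(s * (s + 1) * (s + 2) * x ^ (-s - 3)) := by
  refine ⟨fun x => -s * x ^ (-s - 1), fun x => -s * ((-s - 1) * x ^ (-s - 1 - 1)),
    fun x hx => ⟨?_, ?_, ?_⟩⟩
  · exact Real.hasDerivAt_rpow_const (Or.inl hx.ne')
  · exact (Real.hasDerivAt_rpow_const (Or.inl hx.ne')).const_mul _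
  · have h := ((Real.hasDerivAt_rpow_const (x := x) (p := -s - 1 - 1)
      (Or.inl hx.ne')).const_mul (-s - 1)).const_mul (-s)
    refine h.congr_deriv ?_
    rw [show -s - 1 - 1 - 1 = -s - 3 by ring]
    ring

lemma hasThirdDeriv_log_div :
    HasThirdDeriv (fun x => Real.log x / x) fun x => (11 - 6 * Real.log x) / x ^ 4 := by
  refine ⟨fun x => (1 - Real.log x) / x ^ 2, fun x => (2 * Real.log x - 3) / x ^ 3,
    fun x hx => ⟨?_, ?_, ?_⟩⟩
  · refine ((Real.hasDerivAt_log hx.ne').div (hasDerivAt_id x) hx.ne').congr_deriv ?_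
    simp only [id]
    field_simp
  · refine (((Real.hasDerivAt_log hx.ne').const_sub 1).div (hasDerivAt_pow 2 x)
      (by positivity)).congr_deriv ?_
    push_cast
    field_simp
    ring
  · refine ((((Real.hasDerivAt_log hx.ne').const_mul 2).sub_const 3).div (hasDerivAt_pow 3 x)
      (by positivity)).congr_deriv ?_
    push_cast
    field_simp
    ring

/-- The mean value theorem for third differences. -/
lemma HasThirdDeriv.exists_third_difference_eq {g g₃ : ℝ → ℝ} (hg : HasThirdDeriv g g₃) {a : ℝ}
    (ha : 0 < a) :
    ∃ ξ, a < ξ ∧ ξ < a + 3 ∧ g (a + 3) - 3 * g (a + 2) + 3 * g (a + 1) - g a = g₃ ξ := by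
  obtain ⟨g₁, g₂, hg⟩ := hg
  have mvt : ∀ (f f' : ℝ → ℝ) (c : ℝ), (∀ x, c ≤ x → HasDerivAt f (f' x) x) →
      ∃ ξ, c < ξ ∧ ξ < c + 1 ∧ f (c + 1) - f c = f' ξ := fun f f' c hf => by
    obtain ⟨ξ, ⟨h1, h2⟩, h3⟩ := exists_hasDerivAt_eq_slope f f' (lt_add_one c)
      (fun x hx => (hf x hx.1).continuousAt.continuousWithinAt) (fun x hx => hf x hx.1.le)
    exact ⟨ξ, h1, h2, by rw [h3]; ring⟩
  have shift : ∀ (f f' : ℝ → ℝ) (c x : ℝ), HasDerivAt f (f' (x + c)) (x + c) →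
      HasDerivAt (fun y => f (y + c)) (f' (x + c)) x := fun f f' c x h => h.comp_add_const x c
  obtain ⟨ξ₁, h1, h1', e1⟩ := mvt (fun x => g (x + 2) - 2 * g (x + 1) + g x)
    (fun x => g₁ (x + 2) - 2 * g₁ (x + 1) + g₁ x) a fun x hx =>
    ((shift g g₁ 2 x (hg _ (by linarith)).1).sub
      ((shift g g₁ 1 x (hg _ (by linarith)).1).const_mul 2)).add (hg x (by linarith)).1
  obtain ⟨ξ₂, h2, h2', e2⟩ := mvt (fun x => g₁ (x + 1) - g₁ x)
    (fun x => g₂ (x + 1) - g₂ x) ξ₁ fun x hx =>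
    (shift g₁ g₂ 1 x (hg _ (by linarith)).2.1).sub (hg x (by linarith)).2.1
  obtain ⟨ξ₃, h3, h3', e3⟩ := mvt g₂ g₃ ξ₂ fun x hx => (hg x (by linarith)).2.2
  refine ⟨ξ₃, by linarith, by linarith, ?_⟩
  rw [← e3, ← e2]
  have e1' : g₁ (ξ₁ + 1 + 1) - g₁ (ξ₁ + 1) - (g₁ (ξ₁ + 1) - g₁ ξ₁) =
    g₁ (ξ₁ + 2) - 2 * g₁ (ξ₁ + 1) + g₁ ξ₁ := by
    rw [show ξ₁ + 1 + 1 = ξ₁ + 2 by ring]; ring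
  rw [e1', ← e1, show a + 1 + 2 = a + 3 by ring, show a + 1 + 1 = a + 2 by ring]
  ring

end ThirdDifference

section Final
open Finset

/-- The smooth approximation of `log (rseq α n)`. -/
noncomputable def logApprox (α x : ℝ) : ℝ :=
  π * x ^ (-(1 / 2) : ℝ) + -Real.log 8 * x ^ (-1 : ℝ) + -(α + 1) * (Real.log x / x) +
    ∑ k ∈ range 5, -(1 / (π ^ (k + 1) * (k + 1))) * x ^ (-((k : ℝ) + 3) / 2)

lemma rpow_neg_half_eq {x : ℝ} (hx : 0 < x) (k : ℕ) : x ^ (-(k : ℝ) / 2) = ((√x) ^ k)⁻¹ := by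
  rw [Real.sqrt_eq_rpow, ← Real.rpow_natCast, ← Real.rpow_mul hx.le, ← Real.rpow_neg hx.le]
  ring_nf

lemma fdiff_three (f : ℕ → ℝ) (n : ℕ) :
    (fdiff^[3] f) n = f (n + 3) - 3 * f (n + 2) + 3 * f (n + 1) - f n := by
  simp only [Function.iterate_succ, Function.iterate_zero, Function.comp_apply, fdiff, id,
    add_assoc]
  norm_num
  ring

lemma log_rseq (α : ℝ) {n : ℕ} (hn : 5505 ≤ n) :
    0 < rseq α n ∧ |Real.log (rseq α n) - logApprox α n| ≤ 5 / 4 * (1 / (n : ℝ) ^ 4) := by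
  obtain ⟨hp, hlog⟩ := pbar_pos_and_log_expansion hn
  have hn0 : (0 : ℝ) < n := by
    have : (5505 : ℝ) ≤ n := by exact_mod_cast hn
    linarith
  have hq : 0 < (pbar n : ℝ) / (n : ℝ) ^ α := by positivity
  refine ⟨Real.rpow_pos_of_pos hq _, ?_⟩
  have hr : Real.log (rseq α n) = (n : ℝ)⁻¹ * (Real.log (pbar n) - α * Real.log n) := by
    rw [rseq, Real.log_rpow hq, Real.log_div hp.ne' (by positivity), Real.log_rpow hn0]
  have hs0 : 0 < √(n : ℝ) := Real.sqrt_pos.2 hn0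
  have hs2 : √(n : ℝ) ^ 2 = n := Real.sq_sqrt hn0.le
  have ha : logApprox α n = (n : ℝ)⁻¹ * ((π * √n - Real.log 8 - Real.log n -
      ∑ k ∈ range 5, (1 / (π * √n)) ^ (k + 1) / (k + 1)) - α * Real.log n) := by
    have e1 : (n : ℝ) ^ (-(1 / 2) : ℝ) = (n : ℝ)⁻¹ * √n := by
      have := rpow_neg_half_eq hn0 1
      rw [show (-(1 / 2) : ℝ) = -((1 : ℕ) : ℝ) / 2 by norm_num, this, pow_one]
      nth_rewrite 2 [← hs2]
      field_simp
    have e2 : ∀ k ∈ range 5, -(1 / (π ^ (k + 1) * ((k : ℝ) + 1))) * (n : ℝ) ^ (-((k : ℝ) + 3) / 2) =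
        -((n : ℝ)⁻¹ * ((1 / (π * √n)) ^ (k + 1) / (k + 1))) := fun k _ => by
      have := rpow_neg_half_eq hn0 (k + 3)
      push_cast at this
      have e : √(n : ℝ) ^ (k + 3) = √(n : ℝ) ^ (k + 1) * n := by
        calc √(n : ℝ) ^ (k + 3) = √(n : ℝ) ^ (k + 1) * √(n : ℝ) ^ 2 := by ring
          _ = _ := by rw [hs2]
      rw [this, e, div_pow, mul_pow, one_pow]
      field_simp
    rw [logApprox, Finset.sum_congr rfl e2, e1, Real.rpow_neg_one, Finset.sum_neg_distrib,
      ← Finset.mul_sum]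
    ring
  rw [hr, ha, ← mul_sub, abs_mul, abs_of_pos (by positivity), inv_mul_le_iff₀ hn0]
  have e3 : Real.log (pbar n) - α * Real.log n - ((π * √n - Real.log 8 - Real.log n -
      ∑ k ∈ range 5, (1 / (π * √n)) ^ (k + 1) / ((k : ℝ) + 1)) - α * Real.log n) =
      Real.log (pbar n) - (π * √n - Real.log 8 - Real.log n -
      ∑ k ∈ range 5, (1 / (π * √n)) ^ (k + 1) / ((k : ℝ) + 1)) := by ring
  rw [e3]
  refine hlog.trans (le_of_eq ?_)
  field_simp

lemma hasThirdDeriv_logApprox (α : ℝ) :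
    HasThirdDeriv (logApprox α) fun x =>
      π * -(1 / 2 * (1 / 2 + 1) * (1 / 2 + 2) * x ^ (-(1 / 2) - 3 : ℝ)) +
      -Real.log 8 * -(1 * (1 + 1) * (1 + 2) * x ^ (-1 - 3 : ℝ)) +
      -(α + 1) * ((11 - 6 * Real.log x) / x ^ 4) +
      ∑ k ∈ range 5, -(1 / (π ^ (k + 1) * (k + 1))) *
        -(((k : ℝ) + 3) / 2 * (((k : ℝ) + 3) / 2 + 1) * (((k : ℝ) + 3) / 2 + 2) *
          x ^ (-((k : ℝ) + 3) / 2 - 3)) := by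
  refine ((((hasThirdDeriv_rpow_neg (1 / 2)).const_mul π).add
    ((hasThirdDeriv_rpow_neg 1).const_mul _)).add (hasThirdDeriv_log_div.const_mul _)).add
    (HasThirdDeriv.sum _ fun k _ => ?_)
  have := (hasThirdDeriv_rpow_neg (((k : ℝ) + 3) / 2)).const_mul (-(1 / (π ^ (k + 1) * ((k : ℝ) + 1))))
  simpa only [neg_div] using this

/-- The main term dominates once `x ≥ 5505` and `(Crα 3 α / Cr 3) ^ 4 ≤ x`. -/
lemma third_deriv_logApprox_lt {α x : ℝ} (hα : 0 ≤ α) (hx : 5505 ≤ x)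
    (hC : (Crα 3 α / Cr 3) ^ 4 ≤ x) :
      π * -(1 / 2 * (1 / 2 + 1) * (1 / 2 + 2) * x ^ (-(1 / 2) - 3 : ℝ)) +
      -Real.log 8 * -(1 * (1 + 1) * (1 + 2) * x ^ (-1 - 3 : ℝ)) +
      -(α + 1) * ((11 - 6 * Real.log x) / x ^ 4) +
      ∑ k ∈ range 5, -(1 / (π ^ (k + 1) * (k + 1))) *
        -(((k : ℝ) + 3) / 2 * (((k : ℝ) + 3) / 2 + 1) * (((k : ℝ) + 3) / 2 + 2) *
          x ^ (-((k : ℝ) + 3) / 2 - 3)) < -(12 * (1 / x ^ 4)) := by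
  have hx0 : 0 < x := by linarith
  have hπ3 := Real.pi_gt_three
  have hCr : Cr 3 = 15 / 8 * π := by
    simp [Cr, ascPochhammer_succ_eval]
    ring
  have hCra : Crα 3 α = 6 * (α + 1) + 2 * Real.log 8 + 1 := by
    simp [Crα, Nat.factorial]
    ring
  rw [hCr, hCra] at hC
  set s := √x with hs
  have hs2 : s ^ 2 = x := Real.sq_sqrt hx0.le
  have hs0 : 0 < s := Real.sqrt_pos.2 hx0
  have hs74 : 74 ≤ s := Real.le_sqrt_of_sq_le (by norm_num; linarith)
  set z := √s with hz
  have hz2 : z ^ 2 = s := Real.sq_sqrt hs0.le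
  have hz0 : 0 < z := Real.sqrt_pos.2 hs0
  have hz8 : 8.6 ≤ z := Real.le_sqrt_of_sq_le (by norm_num; linarith)
  have hz4 : z ^ 4 = x := by rw [← hs2, ← hz2]; ring
  have hlog2 := Real.log_two_gt_d9
  have hlog2' := Real.log_two_lt_d9
  have hlog8 : Real.log 8 = 3 * Real.log 2 := by
    rw [show (8 : ℝ) = 2 ^ 3 by norm_num, Real.log_pow]; norm_num
  have hlogx : Real.log x ≤ z + 1.55 := by
    have h1 : Real.log (z / 4) ≤ z / 4 - 1 := Real.log_le_sub_one_of_pos (by positivity)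
    rw [Real.log_div hz0.ne' (by norm_num), show (4 : ℝ) = 2 ^ 2 by norm_num, Real.log_pow] at h1
    rw [← hz4, Real.log_pow]
    norm_num at h1 ⊢
    linarith
  have hmain : (6 * (α + 1) + 2 * Real.log 8 + 1) * z ≤ 15 / 8 * π * s := by
    have h1 : (6 * (α + 1) + 2 * Real.log 8 + 1) / (15 / 8 * π) ≤ z := by
      rw [← hz4] at hC
      exact le_of_pow_le_pow_left₀ (by norm_num) hz0.le hC
    rw [div_le_iff₀ (by positivity)] at h1
    rw [← hz2]
    nlinarith
  have e1 : x ^ (-(1 / 2) - 3 : ℝ) = s * (1 / x ^ 4) := by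
    have := rpow_neg_half_eq hx0 7
    rw [show (-(1 / 2) - 3 : ℝ) = -((7 : ℕ) : ℝ) / 2 by norm_num, this, ← hs, ← hs2]
    field_simp
  have e2 : x ^ (-1 - 3 : ℝ) = 1 / x ^ 4 := by
    rw [show (-1 - 3 : ℝ) = -((4 : ℕ) : ℝ) by norm_num, Real.rpow_neg hx0.le, Real.rpow_natCast,
      one_div]
  have hsum : ∑ k ∈ range 5, -(1 / (π ^ (k + 1) * ((k : ℝ) + 1))) *
        -(((k : ℝ) + 3) / 2 * (((k : ℝ) + 3) / 2 + 1) * (((k : ℝ) + 3) / 2 + 2) *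
          x ^ (-((k : ℝ) + 3) / 2 - 3)) ≤ ∑ k ∈ range 5, 29 / 74 * (1 / x ^ 4) := by
    refine Finset.sum_le_sum fun k hk => ?_
    have hk4 : (k : ℝ) ≤ 4 := by
      have := Finset.mem_range.1 hk
      exact_mod_cast (by omega : k ≤ 4)
    have hk0 : (0 : ℝ) ≤ k := Nat.cast_nonneg k
    have h1 : x ^ (-((k : ℝ) + 3) / 2 - 3) ≤ 1 / 74 * (1 / x ^ 4) := by
      have := rpow_neg_half_eq hx0 (k + 9)
      rw [show -((k : ℝ) + 3) / 2 - 3 = -((k + 9 : ℕ) : ℝ) / 2 by push_cast; ring, this, ← hs,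
        ← hs2, ← one_div, one_div_mul_one_div]
      refine one_div_le_one_div_of_le (by positivity) ?_
      rw [← pow_mul, pow_add]
      calc 74 * s ^ (2 * 4) ≤ s * s ^ (2 * 4) := by gcongr
        _ = 1 * s ^ 9 := by ring
        _ ≤ _ := by gcongr; exact one_le_pow₀ (by linarith)
    have h2 : 1 / (π ^ (k + 1) * ((k : ℝ) + 1)) ≤ 1 / 3 := by
      refine one_div_le_one_div_of_le (by norm_num) ?_
      calc (3 : ℝ) = 3 * 1 := by norm_num
        _ ≤ π ^ (k + 1) * ((k : ℝ) + 1) := by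
          gcongr
          · exact hπ3.le.trans (le_self_pow₀ (by linarith) (by omega))
          · linarith
    have h3 : ((k : ℝ) + 3) / 2 * (((k : ℝ) + 3) / 2 + 1) * (((k : ℝ) + 3) / 2 + 2) ≤ 87 := by
      calc _ ≤ ((4 : ℝ) + 3) / 2 * (((4 : ℝ) + 3) / 2 + 1) * (((4 : ℝ) + 3) / 2 + 2) := by gcongr
        _ ≤ _ := by norm_num
    rw [neg_mul_neg]
    calc _ ≤ 1 / 3 * (87 * (1 / 74 * (1 / x ^ 4))) := by gcongr
      _ = _ := by ring
  rw [Finset.sum_const, Finset.card_range, nsmul_eq_mul] at hsum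
  rw [e1, e2]
  have hw : 0 < 1 / x ^ 4 := by positivity
  have hdiv : (11 - 6 * Real.log x) / x ^ 4 = (11 - 6 * Real.log x) * (1 / x ^ 4) := by
    rw [mul_one_div]
  rw [hdiv]
  generalize 1 / x ^ 4 = w at *
  have hlogα : (α + 1) * (6 * Real.log x - 11) ≤ (α + 1) * (6 * z) := by
    refine mul_le_mul_of_nonneg_left ?_ (by linarith)
    norm_num at hlogx
    linarith
  have hfin : -(15 / 8 * π * s) + 6 * Real.log 8 + (α + 1) * (6 * Real.log x - 11) + 5 * (29 / 74)
      < -12 := by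
    rw [hlog8] at hmain ⊢
    norm_num at hz8
    nlinarith
  have := mul_lt_mul_of_pos_right hfin hw
  push_cast at hsum
  linarith

lemma abs_log_rseq_add_sub_le (α : ℝ) {n : ℕ} (hn : 5505 ≤ n) (j : ℕ) :
    |Real.log (rseq α (n + j)) - logApprox α ((n : ℝ) + j)| ≤ 5 / 4 * (1 / (n : ℝ) ^ 4) := by
  have hn0 : (0 : ℝ) < n := by exact_mod_cast (by omega : 0 < n)
  have h := (log_rseq α (n := n + j) (by omega)).2
  rw [Nat.cast_add] at h
  refine h.trans (mul_le_mul_of_nonneg_left (one_div_le_one_div_of_le (by positivity) ?_)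
    (by norm_num))
  exact pow_le_pow_left₀ hn0.le (le_add_of_nonneg_right (Nat.cast_nonneg j)) 4

lemma third_difference_logApprox_lt {α : ℝ} (hα : 0 ≤ α) {x : ℝ} (hx : 5505 ≤ x)
    (hC : (Crα 3 α / Cr 3) ^ 4 ≤ x) :
    logApprox α (x + 3) - 3 * logApprox α (x + 2) + 3 * logApprox α (x + 1) - logApprox α x <
      -(10 * (1 / x ^ 4)) := by
  have hx0 : 0 < x := by linarith
  obtain ⟨ξ, h1, h2, h3⟩ := (hasThirdDeriv_logApprox α).exists_third_difference_eq hx0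
  rw [h3]
  refine (third_deriv_logApprox_lt hα (by linarith) (by linarith)).trans_le (neg_le_neg ?_)
  have hξx : ξ ≤ 1.04 * x := by norm_num; linarith
  have hξ0 : 0 < ξ := by linarith
  have : ξ ^ 4 ≤ 1.2 * x ^ 4 := by
    calc ξ ^ 4 ≤ (1.04 * x) ^ 4 := pow_le_pow_left₀ hξ0.le hξx 4
      _ = 1.04 ^ 4 * x ^ 4 := by ring
      _ ≤ _ := mul_le_mul_of_nonneg_right (by norm_num) (by positivity)
  rw [mul_one_div, mul_one_div, div_le_div_iff₀ (by positivity) (by positivity)]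
  norm_num at this
  linarith

lemma third_difference_log_rseq_neg {α : ℝ} (hα : 0 ≤ α) {n : ℕ} (hn : 5505 ≤ n)
    (hC : (Crα 3 α / Cr 3) ^ 4 ≤ n) :
    Real.log (rseq α (n + 3)) - 3 * Real.log (rseq α (n + 2)) + 3 * Real.log (rseq α (n + 1)) -
      Real.log (rseq α n) < 0 := by
  have h := third_difference_logApprox_lt hα (x := n) (by exact_mod_cast hn) hC
  have h0 := (abs_le.1 (abs_log_rseq_add_sub_le α hn 0)).1
  have h1 := (abs_le.1 (abs_log_rseq_add_sub_le α hn 1)).2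
  have h2 := (abs_le.1 (abs_log_rseq_add_sub_le α hn 2)).1
  have h3 := (abs_le.1 (abs_log_rseq_add_sub_le α hn 3)).2
  rw [Nat.cast_zero, add_zero, add_zero] at h0
  rw [Nat.cast_one] at h1
  rw [Nat.cast_ofNat] at h2 h3
  linarith

lemma cutoff_facts {α : ℝ} {n : ℕ} (hn : Ncut 3 α ≤ n) :
    5505 ≤ n ∧ (Crα 3 α / Cr 3) ^ 4 ≤ n := by
  have h1 : N₃ 3 α ≤ n := ((le_max_right _ _).trans (le_max_right _ _)).trans hn
  constructor
  · have : (5505 : ℝ) ≤ n := ((le_max_left _ _).trans (le_max_left _ _)).trans h1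
    exact_mod_cast this
  · exact (Int.le_ceil _).trans (((le_max_right _ _).trans (le_max_right _ _)).trans h1)

lemma mul_div_lt_sq_div_of_log {a b c d : ℝ} (ha : 0 < a) (hb : 0 < b) (hc : 0 < c) (hd : 0 < d)
    (h : Real.log d - 3 * Real.log c + 3 * Real.log b - Real.log a < 0) :
    b / a * (d / c) < (c / b) ^ 2 := by
  rw [← Real.log_lt_log_iff (by positivity) (by positivity), Real.log_pow,
    Real.log_mul (by positivity) (by positivity), Real.log_div hb.ne' ha.ne',
    Real.log_div hd.ne' hc.ne', Real.log_div hc.ne' hb.ne']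
  push_cast
  linarith

end Final

end Overpartition

theorem stmt4 (α : ℝ) (hα : 0 ≤ α) (n : ℕ) (hn : Ncut 3 α ≤ (n : ℝ)) :
    (fdiff^[3] (fun m => Real.log (rseq α m))) n < 0 ∧
    (rseq α (n + 2) / rseq α (n + 1)) ^ 2 >
      (rseq α (n + 1) / rseq α n) * (rseq α (n + 3) / rseq α (n + 2)) := by
  obtain ⟨hn1, hC⟩ := Overpartition.cutoff_facts hn
  have h := Overpartition.third_difference_log_rseq_neg hα hn1 hC
  refine ⟨by rw [Overpartition.fdiff_three]; exact h, ?_⟩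
  have hpos : ∀ j : ℕ, 0 < rseq α (n + j) := fun j => (Overpartition.log_rseq α (by omega)).1
  exact Overpartition.mul_div_lt_sq_div_of_log (hpos 0) (hpos 1) (hpos 2) (hpos 3) h
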